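/- Let P be a simple polygon and W a witness set of P; assume Vis(u) equals the closure of its interior for every u ∈ W. Let w ∈ W and let w′ ∈ Vis(w) be a point such that for every v ∈ W adjacent to w in GCon(W), every connected component NV of NVis(W) attached to both Vis(w) and Vis(v), and every window e of Vis(v) with e ⊆ closure(NV), the point w′ is not visible from any point of e. Then (W \ {w}) ∪ {w′} is a witness set of P of cardinality |W|. -/

import Mathlib

open Set

noncomputable section

abbrev Plane := EuclideanSpace ℝ (Fin 2)

/-- A simple polygon, given by a cyclic sequence of at least three distinct vertices
whose closed polygonal boundary curve is a Jordan polygon: two edges intersect exactly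
when they are consecutive, and then only in their one shared endpoint. -/
structure SimplePolygon where
  n : ℕ
  three_le : 3 ≤ n
  vertex : ℕ → Plane
  periodic : ∀ i, vertex (i + n) = vertex i
  inj : ∀ i < n, ∀ j < n, vertex i = vertex j → i = j
  jordan : ∀ i < n, ∀ j < n, i ≠ j →
    segment ℝ (vertex i) (vertex (i + 1)) ∩ segment ℝ (vertex j) (vertex (j + 1)) =
      if j = (i + 1) % n then {vertex (i + 1)}
      else if i = (j + 1) % n then {vertex (j + 1)}
      else ∅

namespace SimplePolygon

/-- The boundary curve of the polygon: the union of its edges. -/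
def boundary (P : SimplePolygon) : Set Plane :=
  ⋃ i ∈ Finset.range P.n, segment ℝ (P.vertex i) (P.vertex (i + 1))

/-- The polygon as a region: the boundary together with all bounded connected
components of the complement of the boundary. -/
def region (P : SimplePolygon) : Set Plane :=
  P.boundary ∪ {x | x ∉ P.boundary ∧
    Bornology.IsBounded (connectedComponentIn P.boundaryᶜ x)}

/-- Visibility region of a point `p`: all points `q` of the polygon such that the
closed segment `[p,q]` is contained in the polygon. -/
def Vis (P : SimplePolygon) (p : Plane) : Set Plane :=
  {q | q ∈ P.region ∧ segment ℝ p q ⊆ P.region}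

/-- Visibility region of a set. -/
def VisSet (P : SimplePolygon) (S : Set Plane) : Set Plane :=
  ⋃ p ∈ S, P.Vis p

/-- Two points of the polygon are visible to each other if the segment joining them
lies in the polygon. -/
def Visible (P : SimplePolygon) (p q : Plane) : Prop :=
  p ∈ P.region ∧ q ∈ P.region ∧ segment ℝ p q ⊆ P.region

/-- A witness set: a finite set of points of the polygon with pairwise disjoint
visibility regions. -/
def IsWitnessSet (P : SimplePolygon) (W : Set Plane) : Prop :=
  W.Finite ∧ W ⊆ P.region ∧
    ∀ x ∈ W, ∀ y ∈ W, x ≠ y → P.Vis x ∩ P.Vis y = ∅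

/-- The non-visible region of a witness set. -/
def NVis (P : SimplePolygon) (W : Set Plane) : Set Plane :=
  P.region \ ⋃ w ∈ W, P.Vis w

/-- `Vis p` is regular (has no arms) if it equals the closure of its interior. -/
def VisRegular (P : SimplePolygon) (p : Plane) : Prop :=
  P.Vis p = closure (interior (P.Vis p))

/-- A window of `Vis p`: a non-degenerate closed segment contained in the frontier of
`Vis p` whose intersection with the frontier of the polygon is exactly its two
endpoints, maximal with these properties. -/
def IsWindow (P : SimplePolygon) (p : Plane) (e : Set Plane) : Prop :=
  ∃ a b : Plane, a ≠ b ∧ e = segment ℝ a b ∧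
    e ⊆ frontier (P.Vis p) ∧
    e ∩ frontier P.region = {a, b} ∧
    ∀ a' b' : Plane, a' ≠ b' →
      segment ℝ a' b' ⊆ frontier (P.Vis p) →
      segment ℝ a' b' ∩ frontier P.region = {a', b'} →
      e ⊆ segment ℝ a' b' → e = segment ℝ a' b'

/-- `γ` is (the image of) a neighbor witness path between `w` and `w'`. -/
def IsNWPath (P : SimplePolygon) (W : Set Plane) (w w' : Plane) (γ : Set Plane) : Prop :=
  ∃ f : Path w w', γ = Set.range f ∧ γ ⊆ P.Vis w ∪ P.NVis W ∪ P.Vis w'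

/-- Adjacency in the neighbor witness graph `GCon(W)`. -/
def GConAdj (P : SimplePolygon) (W : Set Plane) (w w' : Plane) : Prop :=
  w ∈ W ∧ w' ∈ W ∧ w ≠ w' ∧ ∃ γ : Set Plane, P.IsNWPath W w w' γ

/-- A connected component `NV` of `NVis W` is attached to `Vis w` if the closure of
`NV` intersects `Vis w`. -/
def Attached (P : SimplePolygon) (NV : Set Plane) (w : Plane) : Prop :=
  (closure NV ∩ P.Vis w).Nonempty

/-- `w` is a simplicial vertex of `GCon(W)`: its neighbors are pairwise adjacent. -/
def Simplicial (P : SimplePolygon) (W : Set Plane) (w : Plane) : Prop :=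
  ∀ u v : Plane, P.GConAdj W w u → P.GConAdj W w v → u ≠ v → P.GConAdj W u v

end SimplePolygon

/-- `NV` is a connected component of `S`. -/
def IsCompOf (NV S : Set Plane) : Prop :=
  ∃ x ∈ S, NV = connectedComponentIn S x

/-- The topological properties shared by a polygonal region `R` and its boundary curve `B`:
complementary pieces of `B` lie inside or outside `R`, the curve is locally a cone, and at most
two of its branches leave any point. -/
structure LocallyPolygonal {E : Type*} [NormedAddCommGroup E] [NormedSpace ℝ E]
    (R B : Set E) : Prop where
  isClosed_region : IsClosed R
  isClosed_boundary : IsClosed B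
  boundary_subset : B ⊆ R
  subset_or_disjoint : ∀ S : Set E, IsPreconnected S → Disjoint S B → S ⊆ R ∨ Disjoint S R
  cone : ∀ p : E, ∃ r > 0, ∀ u : E, ‖u‖ < r → ∀ t : ℝ, 0 < t → t ≤ 1 → p + t • u ∈ B → p + u ∈ B
  two_rays : ∀ p : E, ∃ r > 0, ∀ u₁ u₂ u₃ : E, u₁ ≠ 0 → u₂ ≠ 0 → u₃ ≠ 0 →
    ‖u₁‖ < r → ‖u₂‖ < r → ‖u₃‖ < r → p + u₁ ∈ B → p + u₂ ∈ B → p + u₃ ∈ B →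
    SameRay ℝ u₁ u₂ ∨ SameRay ℝ u₂ u₃ ∨ SameRay ℝ u₁ u₃

namespace LocallyPolygonal

section General

variable {E : Type*} [NormedAddCommGroup E] [NormedSpace ℝ E] {R B : Set E}

theorem mem_of_preconnected (h : LocallyPolygonal R B) {S : Set E} (hS : IsPreconnected S)
    (hSB : ∀ x ∈ S, x ∉ B) {x y : E} (hx : x ∈ S) (hxR : x ∈ R) (hy : y ∈ S) : y ∈ R := by
  rcases h.subset_or_disjoint S hS (Set.disjoint_left.2 hSB) with h1 | h1
  · exact h1 hy
  · exact absurd hxR (Set.disjoint_left.1 h1 hx)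

theorem exists_radius_notMem (h : LocallyPolygonal R B) (p : E) :
    ∃ r > 0, ∀ u : E, ‖u‖ < r → p + u ∉ R → ∀ t : ℝ, 0 < t → t ≤ 1 → p + t • u ∉ R := by
  obtain ⟨r, hr, H⟩ := h.cone p
  refine ⟨r, hr, fun u hu huR t ht ht1 htR => huR ?_⟩
  have hS : IsPreconnected ((fun t : ℝ => p + t • u) '' Set.Ioc 0 1) :=
    isPreconnected_Ioc.image _ (by fun_prop)
  refine h.mem_of_preconnected hS ?_ ⟨t, ⟨ht, ht1⟩, rfl⟩ htR ⟨1, ⟨one_pos, le_rfl⟩, by simp⟩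
  rintro _ ⟨a, ha, rfl⟩ haB
  exact huR (h.boundary_subset (H u hu a ha.1 ha.2 haB))

/-- The defining properties pull back along an affine isomorphism. -/
theorem preimage {F : Type*} [NormedAddCommGroup F] [NormedSpace ℝ F]
    (h : LocallyPolygonal R B) (L : F ≃L[ℝ] E) (v : E) :
    LocallyPolygonal ((fun q => v + L q) ⁻¹' R) ((fun q => v + L q) ⁻¹' B) := by
  have hc : Continuous fun q => v + L q := by fun_prop
  have hr : ∀ r > (0 : ℝ), ∃ r' > (0 : ℝ), ∀ u : F, ‖u‖ < r' → ‖L u‖ < r := by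
    intro r hr
    have := Metric.continuousAt_iff.1 (L.continuous.continuousAt (x := 0)) r hr
    simpa using this
  refine ⟨h.1.preimage hc, h.2.preimage hc, fun x hx => h.3 hx, ?_, ?_, ?_⟩
  · intro S hS hSB
    have h1 := h.subset_or_disjoint _ (hS.image _ hc.continuousOn) ?_
    · rcases h1 with h1 | h1
      · left; exact Set.image_subset_iff.1 h1
      · right
        exact Set.disjoint_left.2 fun x hx hxR => Set.disjoint_left.1 h1 ⟨x, hx, rfl⟩ hxR
    · rw [Set.disjoint_left]
      rintro _ ⟨x, hx, rfl⟩ hxB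
      exact Set.disjoint_left.1 hSB hx hxB
  · intro p
    obtain ⟨r, hr0, H⟩ := h.cone (v + L p)
    obtain ⟨r', hr', H'⟩ := hr r hr0
    refine ⟨r', hr', fun u hu t ht ht1 htB => ?_⟩
    have := H (L u) (H' u hu) t ht ht1
    simp only [Set.mem_preimage, map_add, map_smul, ← add_assoc] at htB this ⊢
    exact this htB
  · intro p
    obtain ⟨r, hr0, H⟩ := h.two_rays (v + L p)
    obtain ⟨r', hr', H'⟩ := hr r hr0
    refine ⟨r', hr', fun u₁ u₂ u₃ h1 h2 h3 n1 n2 n3 b1 b2 b3 => ?_⟩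
    have := H (L u₁) (L u₂) (L u₃) (by simpa using h1) (by simpa using h2) (by simpa using h3)
      (H' _ n1) (H' _ n2) (H' _ n3)
    simp only [Set.mem_preimage, map_add, ← add_assoc] at b1 b2 b3
    have hL : ∀ a b : F, SameRay ℝ (L a) (L b) → SameRay ℝ a b := fun a b hab => by
      simpa using hab.map (L.symm : E →ₗ[ℝ] F)
    rcases this b1 b2 b3 with h | h | h
    · exact Or.inl (hL _ _ h)
    · exact Or.inr (Or.inl (hL _ _ h))
    · exact Or.inr (Or.inr (hL _ _ h))

end General

end LocallyPolygonal

theorem IsPreconnected.subset_interior_of_disjoint_frontier {X : Type*} [TopologicalSpace X]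
    {S R : Set X} (hS : IsPreconnected S) (hR : IsClosed R) (hd : ∀ x ∈ S, x ∉ frontier R) {x : X}
    (hx : x ∈ S) (hxR : x ∈ R) : S ⊆ interior R := by
  have hint : ∀ z ∈ S, z ∈ R → z ∈ interior R := fun z hz hzR => by
    by_contra hzi
    exact hd z hz (by rw [hR.frontier_eq]; exact ⟨hzR, hzi⟩)
  refine hS.subset_left_of_subset_union isOpen_interior hR.isOpen_compl ?_ ?_
    ⟨x, hx, hint x hx hxR⟩
  · exact Set.disjoint_left.2 fun z hz hz' => hz' (interior_subset hz)
  · intro z hz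
    by_cases hzR : z ∈ R
    · exact Or.inl (hint z hz hzR)
    · exact Or.inr hzR

namespace LocallyPolygonal

section Coordinates

variable {R B : Set (ℝ × ℝ)}

theorem exists_two_rays_coord (h : LocallyPolygonal R B) (p : ℝ × ℝ) :
    ∃ r > 0, ∀ a₁ b₁ a₂ b₂ a₃ b₃ : ℝ, (a₁ ≠ 0 ∨ b₁ ≠ 0) → (a₂ ≠ 0 ∨ b₂ ≠ 0) → (a₃ ≠ 0 ∨ b₃ ≠ 0) →
      |a₁| < r → |b₁| < r → |a₂| < r → |b₂| < r → |a₃| < r → |b₃| < r →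
      p + (a₁, b₁) ∈ B → p + (a₂, b₂) ∈ B → p + (a₃, b₃) ∈ B →
      (∃ k > 0, k * a₁ = a₂ ∧ k * b₁ = b₂) ∨ (∃ k > 0, k * a₂ = a₃ ∧ k * b₂ = b₃) ∨
        (∃ k > 0, k * a₁ = a₃ ∧ k * b₁ = b₃) := by
  obtain ⟨r, hr, H⟩ := h.two_rays p
  refine ⟨r, hr, fun a₁ b₁ a₂ b₂ a₃ b₃ n1 n2 n3 h1 h1' h2 h2' h3 h3' B1 B2 B3 => ?_⟩
  have hne : ∀ a b : ℝ, (a ≠ 0 ∨ b ≠ 0) → ((a, b) : ℝ × ℝ) ≠ 0 := by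
    rintro a b hab h0
    simp only [Prod.mk_eq_zero] at h0
    tauto
  have hlt : ∀ a b : ℝ, |a| < r → |b| < r → ‖((a, b) : ℝ × ℝ)‖ < r := fun a b ha hb => by
    simp [Prod.norm_def, ha, hb]
  have hray : ∀ a b a' b' : ℝ, (a ≠ 0 ∨ b ≠ 0) → (a' ≠ 0 ∨ b' ≠ 0) →
      SameRay ℝ ((a, b) : ℝ × ℝ) (a', b') → ∃ k > 0, k * a = a' ∧ k * b = b' := by
    intro a b a' b' h0 h0' hs
    obtain ⟨k, hk, hk'⟩ := hs.exists_pos_left (hne _ _ h0) (hne _ _ h0')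
    refine ⟨k, hk, ?_⟩
    simpa [Prod.ext_iff] using hk'
  rcases H _ _ _ (hne _ _ n1) (hne _ _ n2) (hne _ _ n3) (hlt _ _ h1 h1') (hlt _ _ h2 h2')
    (hlt _ _ h3 h3') B1 B2 B3 with h | h | h
  · exact Or.inl (hray _ _ _ _ n1 n2 h)
  · exact Or.inr (Or.inl (hray _ _ _ _ n2 n3 h))
  · exact Or.inr (Or.inr (hray _ _ _ _ n1 n3 h))

/-- A segment whose endpoints are separated by `R` meets the boundary. -/
theorem exists_mem_boundary (h : LocallyPolygonal R B) {x y : ℝ × ℝ} (hx : x ∈ R) (hy : y ∉ R) :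
    ∃ θ : ℝ, 0 ≤ θ ∧ θ ≤ 1 ∧ x + θ • (y - x) ∈ B := by
  by_contra! hcon
  refine hy (h.mem_of_preconnected (S := (fun θ : ℝ => x + θ • (y - x)) '' Icc 0 1)
    (isPreconnected_Icc.image _ (by fun_prop)) ?_ ⟨0, by simp, by simp⟩ hx ⟨1, by simp, by simp⟩)
  rintro _ ⟨θ, hθ, rfl⟩
  exact hcon θ hθ.1 hθ.2

theorem opposite_corner_subset (h : LocallyPolygonal R B) {p : ℝ × ℝ}
    (hreg : p ∈ closure (interior R))
    {t₁ t₂ : ℝ} (ht₁ : 0 < t₁) (ht₂ : 0 < t₂)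
    (hs : ∀ t, 0 < t → t < t₁ → p + (t, 0) ∈ R) (hd : ∀ t, 0 < t → t < t₂ → p + (0, -t) ∈ R)
    (hx : ∀ ε > 0, ∃ a b, 0 < a ∧ a < ε ∧ 0 < b ∧ b < ε ∧ p + (a, -b) ∉ R) :
    ∃ ρ > 0, ∀ α β, |α| < ρ → |β| < ρ → (0 < β ∨ α < 0) → p + (α, β) ∈ R := by
  obtain ⟨r, hr, H⟩ := h.exists_two_rays_coord p
  obtain ⟨a, b, ha, har, hb, hbr, hab⟩ := hx r hr
  obtain ⟨t, ht, htt⟩ : ∃ t, 0 < t ∧ t < min r (min t₁ t₂) :=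
    exists_between (lt_min hr (lt_min ht₁ ht₂))
  simp only [lt_min_iff] at htt
  obtain ⟨htr, htt1, htt2⟩ := htt
  have hsR := hs t ht htt1
  have hdR := hd t ht htt2
  obtain ⟨θ, hθ0, hθ1, hθB⟩ := h.exists_mem_boundary hsR hab
  obtain ⟨φ, hφ0, hφ1, hφB⟩ := h.exists_mem_boundary hdR hab
  have hθ1' : θ < 1 := lt_of_le_of_ne hθ1 (by
    rintro rfl; exact hab (h.boundary_subset (by rwa [one_smul, add_sub_cancel] at hθB)))
  have hφ1' : φ < 1 := lt_of_le_of_ne hφ1 (by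
    rintro rfl; exact hab (h.boundary_subset (by rwa [one_smul, add_sub_cancel] at hφB)))
  set A₁ := (1 - θ) * t + θ * a with hA₁
  set B₁ := - (θ * b) with hB₁
  set A₂ := φ * a with hA₂
  set B₂ := -((1 - φ) * t + φ * b) with hB₂
  replace hθB : p + (A₁, B₁) ∈ B := by
    convert hθB using 1
    ext
    · simp [A₁]; ring
    · simp [B₁]
  replace hφB : p + (A₂, B₂) ∈ B := by
    convert hφB using 1
    ext
    · simp [A₂]
    · simp [B₂]; ring
  have A1pos : 0 < A₁ := by
    have := mul_pos (sub_pos.2 hθ1') ht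
    positivity
  have B1np : B₁ ≤ 0 := by
    have : 0 ≤ θ * b := by positivity
    linarith
  have A2nn : 0 ≤ A₂ := by positivity
  have B2neg : B₂ < 0 := by
    have := mul_pos (sub_pos.2 hφ1') ht
    have : 0 ≤ φ * b := by positivity
    linarith
  have cr1 : 0 < A₁ * b + B₁ * a := by
    have : A₁ * b + B₁ * a = (1 - θ) * t * b := by rw [hA₁, hB₁]; ring
    rw [this]
    exact mul_pos (mul_pos (sub_pos.2 hθ1') ht) hb
  have cr2 : A₂ * b + B₂ * a < 0 := by
    have : A₂ * b + B₂ * a = -((1 - φ) * t * a) := by rw [hA₂, hB₂]; ring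
    rw [this, neg_lt_zero]
    exact mul_pos (mul_pos (sub_pos.2 hφ1') ht) ha
  have n1 : |A₁| < r := by
    rw [abs_of_pos A1pos]; nlinarith
  have n1' : |B₁| < r := by
    rw [abs_of_nonpos B1np]; nlinarith
  have n2 : |A₂| < r := by
    rw [abs_of_nonneg A2nn]; nlinarith
  have n2' : |B₂| < r := by
    rw [abs_of_neg B2neg]; nlinarith
  have hfree : ∀ α β, |α| < r → |β| < r → (0 < β ∨ α < 0) → p + (α, β) ∉ B := by
    intro α β hα hβ hαβ hBm
    rcases H A₁ B₁ A₂ B₂ α β (Or.inl A1pos.ne') (Or.inr B2neg.ne) (by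
      rcases hαβ with h | h
      · exact Or.inr h.ne'
      · exact Or.inl h.ne) n1 n1' n2 n2' hα hβ hθB hφB hBm with
      ⟨k, hk, e1, e2⟩ | ⟨k, hk, e1, e2⟩ | ⟨k, hk, e1, e2⟩
    · have : A₂ * b + B₂ * a = k * (A₁ * b + B₁ * a) := by rw [← e1, ← e2]; ring
      have := mul_pos hk cr1
      linarith
    · rcases hαβ with h | h
      · have := mul_neg_of_pos_of_neg hk B2neg
        linarith
      · have := mul_nonneg hk.le A2nn
        linarith
    · rcases hαβ with h | h
      · have := mul_nonpos_of_nonneg_of_nonpos hk.le B1np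
        linarith
      · have := mul_pos hk A1pos
        linarith
  have seg : ∀ α β α' β', p + (α, β) ∈ R → p + (α', β') ∉ R →
      ∃ θ : ℝ, 0 ≤ θ ∧ θ ≤ 1 ∧ p + ((1 - θ) * α + θ * α', (1 - θ) * β + θ * β') ∈ B := by
    intro α β α' β' h1 h2
    obtain ⟨θ, h0, h1, hm⟩ := h.exists_mem_boundary h1 h2
    refine ⟨θ, h0, h1, ?_⟩
    convert hm using 1
    ext <;> simp <;> ring
  have cvx : ∀ θ α α' : ℝ, 0 ≤ θ → θ ≤ 1 → |α| < r → |α'| < r → |(1 - θ) * α + θ * α'| < r := by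
    intro θ α α' h0 h1 h2 h3
    rw [abs_lt] at h2 h3 ⊢
    exact (convex_Ioo (-r) r) h2 h3 (sub_nonneg.2 h1) h0 (by ring)
  -- points of the three open quadrants are all inside or all outside
  have hconst : ∀ α β α' β', |α| < r → |β| < r → (0 < β ∨ α < 0) → |α'| < r → |β'| < r →
      (0 < β' ∨ α' < 0) → p + (α, β) ∈ R → p + (α', β') ∈ R := by
    have half : ∀ α β α' β', |α| < r → |β| < r → |α'| < r → |β'| < r →
      ((0 < β ∧ 0 < β') ∨ (α < 0 ∧ α' < 0)) → p + (α, β) ∈ R → p + (α', β') ∈ R := by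
      intro α β α' β' h1 h2 h3 h4 h5 h6
      by_contra h7
      obtain ⟨θ, h0, hle, hm⟩ := seg _ _ _ _ h6 h7
      refine hfree _ _ (cvx θ α α' h0 hle h1 h3) (cvx θ β β' h0 hle h2 h4) ?_ hm
      rcases h5 with ⟨h5, h5'⟩ | ⟨h5, h5'⟩
      · left
        rcases h0.eq_or_lt with rfl | h0
        · simpa using h5
        · have := mul_pos h0 h5'
          have := mul_nonneg (sub_nonneg.2 hle) h5.le
          linarith
      · right
        rcases h0.eq_or_lt with rfl | h0
        · simpa using h5
        · have := mul_neg_of_pos_of_neg h0 h5'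
          have := mul_nonpos_of_nonneg_of_nonpos (sub_nonneg.2 hle) h5.le
          linarith
    intro α β α' β' h1 h2 h3 h4 h5 h6 h7
    have hr2 : |r / 2| < r := by rw [abs_of_pos (by positivity)]; linarith
    have hr2' : |-(r / 2)| < r := by rw [abs_neg]; exact hr2
    have mid : p + (-(r / 2), r / 2) ∈ R := by
      refine half _ _ _ _ h1 h2 hr2' hr2 ?_ h7
      rcases h3 with h3 | h3
      · left; constructor <;> linarith
      · right; constructor <;> linarith
    refine half _ _ _ _ hr2' hr2 h4 h5 ?_ mid
    rcases h6 with h3 | h3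
    · left; constructor <;> linarith
    · right; constructor <;> linarith
  refine ⟨r, hr, fun α β hα hβ hαβ => ?_⟩
  by_contra hout
  have allout : ∀ α' β', |α'| < r → |β'| < r → (0 < β' ∨ α' < 0) → p + (α', β') ∉ R :=
    fun α' β' h1 h2 h3 h4 => hout (hconst _ _ _ _ h1 h2 h3 hα hβ hαβ h4)
  have htr' : |t| < r := by rwa [abs_of_pos ht]
  have h0r : |(0 : ℝ)| < r := by simpa using hr
  have sB : p + (t, 0) ∈ B := by
    obtain ⟨θ, h0, h1, hm⟩ := seg t 0 0 t hsR (allout 0 t h0r htr' (Or.inl ht))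
    rcases h0.eq_or_lt with rfl | h0
    · simpa using hm
    · refine absurd hm (hfree _ _ (cvx _ _ _ h0.le h1 htr' h0r) (cvx _ _ _ h0.le h1 h0r htr') ?_)
      left; have := mul_pos h0 ht; linarith
  have dB : p + (0, -t) ∈ B := by
    have htr'' : |-t| < r := by rwa [abs_neg]
    obtain ⟨θ, h0, h1, hm⟩ := seg 0 (-t) (-t) 0 hdR
      (allout (-t) 0 htr'' h0r (Or.inr (by linarith)))
    rcases h0.eq_or_lt with rfl | h0
    · simpa using hm
    · refine absurd hm (hfree _ _ (cvx _ _ _ h0.le h1 h0r htr'') (cvx _ _ _ h0.le h1 htr'' h0r) ?_)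
      right; have := mul_pos h0 ht; linarith
  have haxes : ∀ α' β', |α'| < r → |β'| < r → α' ≠ 0 → β' ≠ 0 → p + (α', β') ∉ R := by
    intro α' β' h1 h2 h3 h4
    by_cases hq : 0 < β' ∨ α' < 0
    · exact allout _ _ h1 h2 hq
    push Not at hq
    intro hin
    have hα' : 0 < α' := lt_of_le_of_ne hq.2 h3.symm
    have hβ' : β' < 0 := lt_of_le_of_ne hq.1 h4
    obtain ⟨θ, h0, h1', hm⟩ := seg _ _ _ _ hin hab
    have har' : |a| < r := by rwa [abs_of_pos ha]
    have hbr' : |-b| < r := by rwa [abs_neg, abs_of_pos hb]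
    have p1 : 0 < (1 - θ) * α' + θ * a := by
      rcases h0.eq_or_lt with rfl | h0
      · simpa using hα'
      · have := mul_pos h0 ha
        have := mul_nonneg (sub_nonneg.2 h1') hα'.le
        linarith
    have p2 : (1 - θ) * β' + θ * -b < 0 := by
      rcases h0.eq_or_lt with rfl | h0
      · simpa using hβ'
      · have := mul_pos h0 hb
        have := mul_nonpos_of_nonneg_of_nonpos (sub_nonneg.2 h1') hβ'.le
        linarith
    rcases H t 0 0 (-t) _ _ (Or.inl ht.ne') (Or.inr (by linarith)) (Or.inl p1.ne') htr' h0r h0r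
      (by rwa [abs_neg]) (cvx _ _ _ h0 h1' h1 har') (cvx _ _ _ h0 h1' h2 hbr') sB dB hm with
      ⟨k, hk, e1, e2⟩ | ⟨k, hk, e1, e2⟩ | ⟨k, hk, e1, e2⟩
    · simp at e2; linarith
    · simp at e1; linarith
    · simp at e2; linarith
  -- hence `R` has empty interior near `p`
  obtain ⟨z, hzball, hzint⟩ := mem_closure_iff.1 hreg (Metric.ball p r) Metric.isOpen_ball
    (Metric.mem_ball_self hr)
  have hopen : IsOpen (Metric.ball p r ∩ interior R) := Metric.isOpen_ball.inter isOpen_interior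
  obtain ⟨ε, hε, hεs⟩ := Metric.isOpen_iff.1 hopen z ⟨hzball, hzint⟩
  obtain ⟨q, hq⟩ : ∃ q ∈ Metric.ball z ε, q.1 - p.1 ≠ 0 ∧ q.2 - p.2 ≠ 0 := by
    have key : ∀ x : ℝ, ∃ x', |x' - (x : ℝ)| < ε ∧ x' ≠ 0 := by
      intro x
      by_cases hx : x = 0
      · refine ⟨ε / 2, ?_, by positivity⟩
        rw [hx, sub_zero, abs_of_pos (by positivity)]; linarith
      · exact ⟨x, by simpa using hε, hx⟩
    obtain ⟨x, hx1, hx2⟩ := key (z.1 - p.1)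
    obtain ⟨y, hy1, hy2⟩ := key (z.2 - p.2)
    refine ⟨(p.1 + x, p.2 + y), ?_, by simpa using hx2, by simpa using hy2⟩
    rw [Metric.mem_ball, Prod.dist_eq, Real.dist_eq, Real.dist_eq, max_lt_iff]
    constructor
    · change |p.1 + x - z.1| < ε
      rwa [show p.1 + x - z.1 = x - (z.1 - p.1) by ring]
    · change |p.2 + y - z.2| < ε
      rwa [show p.2 + y - z.2 = y - (z.2 - p.2) by ring]
  obtain ⟨hqb, hqi⟩ := hεs hq.1
  rw [Metric.mem_ball, Prod.dist_eq, Real.dist_eq, Real.dist_eq, max_lt_iff] at hqb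
  refine haxes _ _ hqb.1 hqb.2 hq.2.1 hq.2.2 ?_
  convert interior_subset hqi using 1
  ext <;> simp

end Coordinates

end LocallyPolygonal

/-- The points of `R` visible from the origin. -/
def originVis (R : Set (ℝ × ℝ)) : Set (ℝ × ℝ) := {q | segment ℝ 0 q ⊆ R}

theorem mem_of_mem_originVis {R : Set (ℝ × ℝ)} {σ τ τ' : ℝ} (h : (τ * σ, τ) ∈ originVis R)
    (h0 : 0 ≤ τ') (hτ : τ' ≤ τ) : (τ' * σ, τ') ∈ R := by
  refine h ?_
  rcases (h0.trans hτ).eq_or_lt with rfl | hpos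
  · obtain rfl : τ' = 0 := le_antisymm hτ h0
    exact right_mem_segment ℝ 0 _
  · rw [segment_eq_image]
    refine ⟨τ' / τ, ⟨by positivity, div_le_one_of_le₀ hτ hpos.le⟩, ?_⟩
    ext <;> simp <;> field_simp

theorem originVis_subset {R : Set (ℝ × ℝ)} : originVis R ⊆ R := fun q hq =>
  hq (right_mem_segment ℝ 0 q)

namespace LocallyPolygonal

section Coordinates

variable {R B : Set (ℝ × ℝ)}

/-- A point outside `R` and close to the ray from the origin hides all points behind it. -/
theorem exists_hidden_of_pos (h : LocallyPolygonal R B) {c : ℝ} (hc : 0 < c) :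
    ∃ δ > 0, ∀ a b, |a| < δ → |b - c| < δ → (a, b) ∉ R → ∀ l, 0 < l → l ≤ 1 →
      ∀ τ, c ≤ τ → b ≤ τ → (τ * (l * (a / b)), τ) ∉ originVis R := by
  obtain ⟨r, hr, H⟩ := h.exists_radius_notMem (0, c)
  refine ⟨min r c, lt_min hr hc, fun a b ha hb hab l hl hl1 τ hcτ hbτ hvis => ?_⟩
  rw [lt_min_iff] at ha hb
  have hb0 : 0 < b := by have := (abs_lt.1 hb.2).1; linarith
  set D := (1 - l) * b + l * c with hD
  have hDpos : 0 < D := by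
    have := mul_pos hl hc
    have := mul_nonneg (sub_nonneg.2 hl1) hb0.le
    linarith
  have hθ1 : l * c / D ≤ 1 := by
    rw [div_le_one hDpos]
    have := mul_nonneg (sub_nonneg.2 hl1) hb0.le
    linarith
  have key := H (a, b - c) (by simp [Prod.norm_def, ha.1, hb.1]) (by simpa using hab) (l * c / D)
    (by positivity) hθ1
  have hpt : ((0, c) : ℝ × ℝ) + (l * c / D) • (a, b - c)
      = (c * b / D * (l * (a / b)), c * b / D) := by
    ext
    · simp; field_simp
    · simp only [Prod.snd_add, Prod.smul_snd, smul_eq_mul]; field_simp; rw [hD]; ring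
  rw [hpt] at key
  refine key (mem_of_mem_originVis hvis (by positivity) ?_)
  rw [div_le_iff₀ hDpos, hD]
  rcases le_total b c with hbc | hbc
  · nlinarith [mul_nonneg (sub_nonneg.2 hl1) hb0.le, mul_nonneg hl.le hc.le,
      mul_nonneg (mul_nonneg hl.le hc.le) (sub_nonneg.2 hbc),
      mul_nonneg (mul_nonneg (sub_nonneg.2 hl1) hb0.le) (sub_nonneg.2 hcτ),
      mul_nonneg (mul_nonneg hl.le hc.le) (sub_nonneg.2 hcτ)]
  · nlinarith [mul_nonneg (mul_nonneg (sub_nonneg.2 hl1) hb0.le) (sub_nonneg.2 hbτ),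
      mul_nonneg (mul_nonneg hl.le hc.le) (sub_nonneg.2 hbτ),
      mul_nonneg (mul_nonneg (sub_nonneg.2 hl1) hb0.le) (sub_nonneg.2 hbc)]

theorem exists_hidden_of_zero (h : LocallyPolygonal R B)
    (hbl : ∀ δ > 0, ∃ σ τ, 0 < σ ∧ σ < δ ∧ 0 < τ ∧ τ < δ ∧ (τ * σ, τ) ∉ R) :
    ∃ σ₀ > 0, ∀ σ, 0 < σ → σ < σ₀ → ∀ τ, 0 < τ → (τ * σ, τ) ∉ originVis R := by
  obtain ⟨r, hr, H⟩ := h.exists_two_rays_coord 0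
  have hfree : ∃ s > 0, ∀ σ, 0 < σ → σ < s → ∀ τ, 0 < τ → τ < r → σ < 1 → (τ * σ, τ) ∉ B := by
    by_contra! hcon
    obtain ⟨σ₁, h1, -, τ₁, t1, t1r, o1, m1⟩ := hcon 1 one_pos
    obtain ⟨σ₂, h2, l2, τ₂, t2, t2r, o2, m2⟩ := hcon σ₁ h1
    obtain ⟨σ₃, h3, l3, τ₃, t3, t3r, o3, m3⟩ := hcon σ₂ h2
    have hb : ∀ σ τ : ℝ, 0 < σ → σ < 1 → 0 < τ → τ < r → |τ * σ| < r ∧ |τ| < r := by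
      intro σ τ a1 a2 a3 a4
      rw [abs_of_pos (mul_pos a3 a1), abs_of_pos a3]
      exact ⟨by nlinarith, a4⟩
    have hn : ∀ σ τ σ' τ' : ℝ, 0 < τ → σ' < σ →
        ¬ ∃ k > 0, k * (τ * σ) = τ' * σ' ∧ k * τ = τ' := by
      rintro σ τ σ' τ' a1 a2 ⟨k, hk, e1, rfl⟩
      have : k * τ * σ = k * τ * σ' := by linarith
      have := mul_left_cancel₀ (mul_pos hk a1).ne' this
      linarith
    rcases H (τ₁ * σ₁) τ₁ (τ₂ * σ₂) τ₂ (τ₃ * σ₃) τ₃ (Or.inr t1.ne') (Or.inr t2.ne') (Or.inr t3.ne')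
      (hb _ _ h1 o1 t1 t1r).1 (hb _ _ h1 o1 t1 t1r).2
      (hb _ _ h2 o2 t2 t2r).1 (hb _ _ h2 o2 t2 t2r).2
      (hb _ _ h3 o3 t3 t3r).1 (hb _ _ h3 o3 t3 t3r).2 (by simpa using m1) (by simpa using m2)
      (by simpa using m3) with h | h | h
    · exact hn _ _ _ _ t1 l2 h
    · exact hn _ _ _ _ t2 l3 h
    · exact hn _ _ _ _ t1 (l3.trans l2) h
  obtain ⟨s, hs, hfree⟩ := hfree
  set δ := min s (min r 1) with hδ
  have hδpos : 0 < δ := by positivity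
  have hδs : δ ≤ s := min_le_left _ _
  have hδr : δ ≤ r := (min_le_right _ _).trans (min_le_left _ _)
  have hδ1 : δ ≤ 1 := (min_le_right _ _).trans (min_le_right _ _)
  set T : Set (ℝ × ℝ) := (fun q : ℝ × ℝ => (q.2 * q.1, q.2)) '' (Ioo 0 δ ×ˢ Ioo 0 δ) with hT
  have hTc : IsPreconnected T :=
    (isPreconnected_Ioo.prod isPreconnected_Ioo).image _ (by fun_prop)
  have hTB : ∀ x ∈ T, x ∉ B := by
    rintro _ ⟨q, ⟨⟨a1, a2⟩, ⟨a3, a4⟩⟩, rfl⟩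
    exact hfree _ a1 (a2.trans_le hδs) _ a3 (a4.trans_le hδr) (a2.trans_le hδ1)
  obtain ⟨σ₁, τ₁, a1, a2, a3, a4, hout⟩ := hbl δ hδpos
  refine ⟨δ, hδpos, fun σ hσ hσδ τ hτ hvis => hout ?_⟩
  have hm : 0 < min τ (δ / 2) := by positivity
  refine h.mem_of_preconnected hTc hTB (x := (min τ (δ / 2) * σ, min τ (δ / 2)))
    ⟨(σ, min τ (δ / 2)), ⟨⟨hσ, hσδ⟩, hm, ?_⟩, rfl⟩
    (mem_of_mem_originVis hvis hm.le (min_le_left _ _)) ⟨(σ₁, τ₁), ⟨⟨a1, a2⟩, a3, a4⟩, rfl⟩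
  exact (min_le_right _ _).trans_lt (by linarith)

end Coordinates

end LocallyPolygonal

/-- Points outside `R` that lie before height `1` and to the right of the vertical axis, in
slope-height coordinates. -/
def blockers (R : Set (ℝ × ℝ)) : Set (ℝ × ℝ) :=
  {q | 0 < q.1 ∧ 0 < q.2 ∧ q.2 < 1 ∧ (q.2 * q.1, q.2) ∉ R}

theorem axis_mem_originVis_iff {R : Set (ℝ × ℝ)} {τ : ℝ} (hτ : 0 ≤ τ) :
    ((0, τ) : ℝ × ℝ) ∈ originVis R ↔ ∀ τ', 0 ≤ τ' → τ' ≤ τ → ((0, τ') : ℝ × ℝ) ∈ R := by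
  constructor
  · intro h τ' h0 h1
    have := mem_of_mem_originVis (σ := 0) (by simpa using h) h0 h1
    simpa using this
  · intro h
    show segment ℝ 0 _ ⊆ R
    rw [segment_eq_image]
    rintro _ ⟨θ, ⟨h0, h1⟩, rfl⟩
    have := h (θ * τ) (mul_nonneg h0 hτ) (mul_le_of_le_one_left hτ h1)
    simpa using this

theorem exists_last_blocked {R : Set (ℝ × ℝ)} (h0 : (0, 0) ∈ R) {t₁ : ℝ} (ht₁ : 0 < t₁)
    (hs : ∀ t, 0 < t → t < t₁ → (t, 1) ∈ R ∧ (t, 1) ∉ originVis R) :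
    ∃ c, 0 ≤ c ∧ c ≤ 1 ∧ (0, c) ∈ closure (blockers R) ∧
      ∀ τ, c < τ → τ ≤ 1 → (0, τ) ∉ closure (blockers R) := by
  set K : Set ℝ := Icc 0 1 ∩ (fun τ : ℝ => ((0, τ) : ℝ × ℝ)) ⁻¹' closure (blockers R)
  have hK : IsCompact K := isCompact_Icc.inter_right (isClosed_closure.preimage (by fun_prop))
  have hne : K.Nonempty := by
    by_contra hemp
    rw [Set.not_nonempty_iff_eq_empty] at hemp
    have hev : ∀ᶠ σ in nhds (0 : ℝ), ∀ τ ∈ Icc (0 : ℝ) 1, (σ, τ) ∉ blockers R := by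
      refine isCompact_Icc.eventually_forall_of_forall_eventually fun τ hτ => ?_
      have hnot : ((0, τ) : ℝ × ℝ) ∉ closure (blockers R) := fun hc => by
        have : τ ∈ K := ⟨hτ, hc⟩
        simp [hemp] at this
      filter_upwards [isClosed_closure.isOpen_compl.mem_nhds hnot] with q hq hq'
      exact hq (subset_closure hq')
    obtain ⟨ε, hε, H⟩ := Metric.eventually_nhds_iff.1 hev
    obtain ⟨σ, hσ, hσ'⟩ := exists_between (lt_min hε ht₁)
    rw [lt_min_iff] at hσ'
    have hvis := (hs σ hσ hσ'.2).2
    apply hvis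
    show segment ℝ 0 _ ⊆ R
    rw [segment_eq_image]
    rintro _ ⟨θ, ⟨h0', h1'⟩, rfl⟩
    have hH := H (y := σ) (by simpa [abs_of_pos hσ] using hσ'.1) θ ⟨h0', h1'⟩
    rcases h0'.eq_or_lt with rfl | hpos
    · simpa [← Prod.mk_zero_zero] using h0
    rcases h1'.eq_or_lt with rfl | hlt
    · simpa using (hs σ hσ hσ'.2).1
    by_contra hout
    exact hH ⟨hσ, hpos, hlt, by simpa using hout⟩
  obtain ⟨c, hc, hmax⟩ := hK.exists_isGreatest hne
  refine ⟨c, hc.1.1, hc.1.2, hc.2, fun τ h1 h2 h3 => ?_⟩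
  have := hmax (show τ ∈ K from ⟨⟨hc.1.1.trans h1.le, h2⟩, h3⟩)
  linarith

theorem mem_closure_compl_of_blocked {R : Set (ℝ × ℝ)} {c : ℝ}
    (hc : (0, c) ∈ closure (blockers R)) : ((0, c) : ℝ × ℝ) ∈ closure Rᶜ := by
  have := map_mem_closure (f := fun q : ℝ × ℝ => (q.2 * q.1, q.2)) (t := Rᶜ) (by fun_prop) hc
    (fun q hq => hq.2.2.2)
  simpa using this

theorem exists_fst_ne_zero {U : Set (ℝ × ℝ)} (hU : IsOpen U) {z : ℝ × ℝ} (hz : z ∈ U) :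
    ∃ q ∈ U, q.1 ≠ 0 := by
  by_contra! hcon
  have hz0 := hcon z hz
  obtain ⟨ε, hε, H⟩ := Metric.isOpen_iff.1 hU z hz
  have := hcon (z.1 + ε / 2, z.2) (H (by
    rw [Metric.mem_ball, Prod.dist_eq, max_lt_iff, Real.dist_eq, dist_self]
    refine ⟨?_, hε⟩
    simp only [add_sub_cancel_left]
    rw [abs_of_pos (by positivity)]; linarith))
  simp only at this
  linarith

/-- The next frontier point of a bounded region along the vertical axis. -/
theorem exists_next_frontier {R : Set (ℝ × ℝ)} (hR : IsClosed R) {τ₀ T : ℝ} (hT : τ₀ ≤ T)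
    (h0 : (0, τ₀) ∈ R) (hout : (0, T) ∉ R) :
    ∃ b, τ₀ ≤ b ∧ (0, b) ∈ frontier R ∧ ∀ τ, τ₀ ≤ τ → τ < b → (0, τ) ∈ interior R := by
  set K : Set ℝ := Icc τ₀ T ∩ (fun τ : ℝ => ((0, τ) : ℝ × ℝ)) ⁻¹' frontier R
  have hK : IsCompact K := isCompact_Icc.inter_right (isClosed_frontier.preimage (by fun_prop))
  have hpre : ∀ s : Set ℝ, IsPreconnected s →
      IsPreconnected ((fun τ : ℝ => ((0, τ) : ℝ × ℝ)) '' s) :=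
    fun s hs => hs.image _ (by fun_prop)
  have hne : K.Nonempty := by
    by_contra hemp
    refine hout (interior_subset ((hpre _ (isPreconnected_Icc (a := τ₀) (b := T))
      ).subset_interior_of_disjoint_frontier hR ?_ ⟨τ₀, ⟨le_rfl, hT⟩, rfl⟩ h0
        ⟨T, ⟨hT, le_rfl⟩, rfl⟩))
    rintro _ ⟨τ, hτ, rfl⟩ hf
    exact hemp ⟨τ, hτ, hf⟩
  obtain ⟨b, hb, hmin⟩ := hK.exists_isLeast hne
  refine ⟨b, hb.1.1, hb.2, fun τ h1 h2 => ?_⟩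
  refine (hpre _ (isPreconnected_Ico (a := τ₀) (b := b))
      ).subset_interior_of_disjoint_frontier hR ?_ ⟨τ₀, ⟨le_rfl, h1.trans_lt h2⟩, rfl⟩ h0
        ⟨τ, ⟨h1, h2⟩, rfl⟩
  rintro _ ⟨τ, hτ, rfl⟩ hf
  have := hmin (show τ ∈ K from ⟨⟨hτ.1, hτ.2.le.trans hb.1.2⟩, hf⟩)
  linarith [hτ.2]

namespace LocallyPolygonal

section Coordinates

variable {R B : Set (ℝ × ℝ)}

theorem exists_hidden_of_blocked (h : LocallyPolygonal R B) {c τ₁ : ℝ} (hc0 : 0 ≤ c)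
    (hc : (0, c) ∈ closure (blockers R)) (hτ₁ : c ≤ τ₁) (hcτ : c < τ₁ ∨ 1 ≤ τ₁) :
    ∃ σ₀ > 0, ∀ σ, 0 < σ → σ < σ₀ → ∀ τ, τ₁ ≤ τ → (τ * σ, τ) ∉ originVis R := by
  rcases hc0.eq_or_lt with rfl | hcpos
  · obtain ⟨σ₀, hσ₀, H⟩ := h.exists_hidden_of_zero (fun δ hδ => by
      obtain ⟨q, hq, hqd⟩ := Metric.mem_closure_iff.1 hc δ hδ
      rw [Prod.dist_eq, max_lt_iff, Real.dist_eq, Real.dist_eq] at hqd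
      simp only [zero_sub, abs_neg] at hqd
      exact ⟨q.1, q.2, hq.1, (le_abs_self _).trans_lt hqd.1, hq.2.1,
        (le_abs_self _).trans_lt hqd.2, hq.2.2.2⟩)
    refine ⟨σ₀, hσ₀, fun σ h1 h2 τ hτ => H σ h1 h2 τ ?_⟩
    rcases hcτ with h | h <;> linarith
  · obtain ⟨δ, hδ, H⟩ := h.exists_hidden_of_pos hcpos
    have hcont : Filter.Tendsto (fun q : ℝ × ℝ => q.2 * q.1) (nhds (0, c)) (nhds 0) := by
      have : Continuous fun q : ℝ × ℝ => q.2 * q.1 := by fun_prop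
      simpa using this.tendsto (0, c)
    have hcont2 : Filter.Tendsto (fun q : ℝ × ℝ => q.2) (nhds (0, c)) (nhds c) :=
      continuous_snd.tendsto (0, c)
    have ev1 := hcont.eventually (Metric.ball_mem_nhds 0 hδ)
    have ev2 := hcont2.eventually (Metric.ball_mem_nhds c hδ)
    have ev3 : ∀ᶠ q : ℝ × ℝ in nhds (0, c), q.2 < 1 → q.2 ≤ τ₁ := by
      rcases hcτ with h | h
      · filter_upwards [hcont2.eventually (gt_mem_nhds h)] with q hq _ using hq.le
      · exact Filter.Eventually.of_forall fun q hq => hq.le.trans h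
    obtain ⟨q, ⟨⟨q1, q2⟩, q3⟩, hq⟩ := mem_closure_iff_nhds.1 hc _ ((ev1.and ev2).and ev3)
    have hq1 : 0 < q.1 := hq.1
    have hq2 : 0 < q.2 := hq.2.1
    refine ⟨q.1, hq1, fun σ h1 h2 τ hτ => ?_⟩
    have := H (q.2 * q.1) q.2 (by simpa using q1) (by simpa [Real.dist_eq] using q2) hq.2.2.2
      (σ / q.1) (by positivity) (by rw [div_le_one hq1]; exact h2.le) τ (hτ₁.trans hτ)
      ((q3 hq.2.2.1).trans hτ)
    rwa [mul_div_cancel_left₀ _ hq2.ne', div_mul_cancel₀ _ hq1.ne'] at this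

/-- Between the last blocking point on one side and the endpoint, a segment of a regular visibility
region has no frontier point. -/
theorem mem_interior_of_not_blocked (h : LocallyPolygonal R B)
    (hreg : originVis R ⊆ closure (interior (originVis R))) (hy : (0, 1) ∈ originVis R)
    {c : ℝ} (hc0 : 0 ≤ c) (hc : (0, c) ∈ closure (blockers R))
    (hlast : ∀ τ, c < τ → τ ≤ 1 → (0, τ) ∉ closure (blockers R)) {τ : ℝ} (hcτ : c < τ)
    (hτ1 : τ < 1) : (0, τ) ∈ interior R := by
  have hax := (axis_mem_originVis_iff zero_le_one).1 hy
  have hτ0 : 0 < τ := hc0.trans_lt hcτ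
  by_contra hint
  rw [← Set.mem_compl_iff, ← closure_compl] at hint
  obtain ⟨δ, hδ, hhide⟩ := h.exists_hidden_of_pos hτ0
  obtain ⟨σ₀, hσ₀, hhide'⟩ := h.exists_hidden_of_blocked hc0 hc hcτ.le (Or.inl hcτ)
  set τm := (τ + 1) / 2 with hτm
  have ev1 : ∀ᶠ q : ℝ × ℝ in nhds (0, τ), (q.1 / q.2, q.2) ∉ blockers R := by
    have hca : ContinuousAt (fun q : ℝ × ℝ => (q.1 / q.2, q.2)) (0, τ) :=
      (continuousAt_fst.div continuousAt_snd hτ0.ne').prodMk continuousAt_snd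
    have hnot : ((0 : ℝ) / τ, τ) ∉ closure (blockers R) := by
      rw [zero_div]; exact hlast τ hcτ hτ1.le
    filter_upwards [hca.eventually (isClosed_closure.isOpen_compl.mem_nhds hnot)] with q hq hq'
    exact hq (subset_closure hq')
  have ev2 : ∀ᶠ q : ℝ × ℝ in nhds (0, τ), |q.1| < δ := by
    have := continuous_fst.tendsto ((0, τ) : ℝ × ℝ) |>.eventually (Metric.ball_mem_nhds _ hδ)
    simpa [Real.dist_eq] using this
  have ev3 : ∀ᶠ q : ℝ × ℝ in nhds (0, τ), |q.2 - τ| < δ := by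
    have := continuous_snd.tendsto ((0, τ) : ℝ × ℝ) |>.eventually (Metric.ball_mem_nhds _ hδ)
    simpa [Real.dist_eq] using this
  have ev4 : ∀ᶠ q : ℝ × ℝ in nhds (0, τ), q.2 < τm :=
    continuous_snd.tendsto ((0, τ) : ℝ × ℝ) |>.eventually (gt_mem_nhds (by simp only; linarith))
  have ev5 : ∀ᶠ q : ℝ × ℝ in nhds (0, τ), 0 < q.2 :=
    continuous_snd.tendsto ((0, τ) : ℝ × ℝ) |>.eventually (lt_mem_nhds hτ0)
  obtain ⟨⟨a, b⟩, ⟨q1, q2, q3, q4, q5⟩, hout⟩ := mem_closure_iff_nhds.1 hint _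
    (ev1.and (ev2.and (ev3.and (ev4.and ev5))))
  simp only at q1 q2 q3 q4 q5
  have ha : a < 0 := by
    by_contra hneg
    rcases (not_lt.1 hneg).eq_or_lt with rfl | hpos
    · exact hout (hax b q5.le (by linarith))
    · refine q1 ⟨div_pos hpos q5, q5, by simp only; linarith, ?_⟩
      simpa [mul_div_cancel₀ _ q5.ne'] using hout
  have hab : a / b < 0 := div_neg_of_neg_of_pos ha q5
  set U : Set (ℝ × ℝ) := {q | max τ b < q.2 ∧ a / b * q.2 < q.1 ∧ q.1 < σ₀ * q.2} with hU
  have hUo : IsOpen U := by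
    exact (isOpen_lt continuous_const continuous_snd).inter ((isOpen_lt
      (continuous_const.mul continuous_snd) continuous_fst).inter
        (isOpen_lt continuous_fst (continuous_const.mul continuous_snd)))
  have hm0 : 0 < τm := by linarith
  have hmU : (0, τm) ∈ U :=
    ⟨max_lt (by simp only; linarith) q4, mul_neg_of_neg_of_pos hab hm0, mul_pos hσ₀ hm0⟩
  have hUvis : ∀ q ∈ U, q.1 ≠ 0 → q ∉ originVis R := by
    rintro ⟨x, y⟩ ⟨h1, h2, h3⟩ hx hvis
    simp only at h1 h2 h3 hx
    rw [max_lt_iff] at h1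
    have hy0 : 0 < y := hτ0.trans h1.1
    have hxy : y * (x / y) = x := mul_div_cancel₀ _ hy0.ne'
    rcases hx.lt_or_gt with hx | hx
    · have hx' : a / b < x / y := by rwa [lt_div_iff₀ hy0]
      have hxn : x / y < 0 := div_neg_of_neg_of_pos hx hy0
      have := hhide a b q2 q3 hout ((x / y) / (a / b)) (div_pos_of_neg_of_neg hxn hab)
        (by rw [div_le_one_of_neg hab]; exact hx'.le) y h1.1.le h1.2.le
      rw [div_mul_cancel₀ _ hab.ne, hxy] at this
      exact this hvis
    · have := hhide' (x / y) (div_pos hx hy0) (by rwa [div_lt_iff₀ hy0]) y h1.1.le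
      rw [hxy] at this
      exact this hvis
  have hmvis : (0, τm) ∈ originVis R :=
    (axis_mem_originVis_iff hm0.le).2 fun τ' h0 h1 => hax τ' h0 (by linarith)
  obtain ⟨z, hzU, hzV⟩ := mem_closure_iff.1 (hreg hmvis) U hUo hmU
  obtain ⟨q, ⟨hqU, hqV⟩, hq0⟩ := exists_fst_ne_zero (hUo.inter isOpen_interior) ⟨hzU, hzV⟩
  exact hUvis q hqU hq0 (interior_subset hqV)

end Coordinates

end LocallyPolygonal

/-- If all points slightly to the right of a vertical segment through height `1` lie in `M`, the
segment is in the closure of the component of `M` containing the horizontal stub at height `1`. -/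
theorem mem_closure_connectedComponentIn {M : Set (ℝ × ℝ)} {τ₁ τ₂ : ℝ} (h1 : τ₁ ≤ 1) (h2 : 1 ≤ τ₂)
    (hev : ∀ τ ∈ Icc τ₁ τ₂, ∀ᶠ q : ℝ × ℝ in nhds (0, τ), 0 < q.1 → q.2 ∈ Icc τ₁ τ₂ →
      (q.2 * q.1, q.2) ∈ M)
    {t₀ : ℝ} (ht₀ : 0 < t₀) (hM : ∀ t, 0 < t → t ≤ t₀ → (t, 1) ∈ M) {τ : ℝ} (hτ : τ ∈ Icc τ₁ τ₂) :
    (0, τ) ∈ closure (connectedComponentIn M (t₀, 1)) := by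
  have hev' : ∀ᶠ σ in nhds (0 : ℝ), ∀ τ ∈ Icc τ₁ τ₂, 0 < σ → τ ∈ Icc τ₁ τ₂ → (τ * σ, τ) ∈ M :=
    isCompact_Icc.eventually_forall_of_forall_eventually
      (P := fun σ τ => 0 < σ → τ ∈ Icc τ₁ τ₂ → (τ * σ, τ) ∈ M) hev
  obtain ⟨ε, hε, H⟩ := Metric.eventually_nhds_iff.1 hev'
  have hH : ∀ σ ∈ Ioo 0 ε, ∀ τ ∈ Icc τ₁ τ₂, (τ * σ, τ) ∈ M := fun σ hσ τ hτ =>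
    H (y := σ) (by simpa [abs_of_pos hσ.1] using hσ.2) τ hτ hσ.1 hτ
  set S : Set (ℝ × ℝ) := (fun q : ℝ × ℝ => (q.2 * q.1, q.2)) '' (Ioo 0 ε ×ˢ Icc τ₁ τ₂)
  set L : Set (ℝ × ℝ) := (fun t : ℝ => (t, (1 : ℝ))) '' Ioc 0 t₀
  have hS : IsPreconnected S := (isPreconnected_Ioo.prod isPreconnected_Icc).image _ (by fun_prop)
  have hL : IsPreconnected L := isPreconnected_Ioc.image _ (by fun_prop)
  obtain ⟨m, hm, hm'⟩ := exists_between (lt_min hε ht₀)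
  rw [lt_min_iff] at hm'
  have hSL : IsPreconnected (S ∪ L) :=
    hS.union (m, 1) ⟨(m, 1), ⟨⟨hm, hm'.1⟩, h1, h2⟩, by simp⟩ ⟨m, ⟨hm, hm'.2.le⟩, rfl⟩ hL
  have hsub : S ∪ L ⊆ connectedComponentIn M (t₀, 1) := by
    refine hSL.subset_connectedComponentIn (Or.inr ⟨t₀, ⟨ht₀, le_rfl⟩, rfl⟩) ?_
    rintro _ (⟨q, ⟨hq1, hq2⟩, rfl⟩ | ⟨t, ht, rfl⟩)
    · exact hH _ hq1 _ hq2
    · exact hM t ht.1 ht.2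
  have hcl : (0 : ℝ) ∈ closure (Ioo 0 ε) := by
    rw [closure_Ioo hε.ne]; exact ⟨le_rfl, hε.le⟩
  have := map_mem_closure (f := fun σ : ℝ => (τ * σ, τ)) (t := S) (by fun_prop) hcl
    (fun σ hσ => ⟨(σ, τ), ⟨hσ, hτ⟩, rfl⟩)
  simp only [mul_zero] at this
  exact closure_mono (subset_union_left.trans hsub) this

namespace LocallyPolygonal

section Coordinates

variable {R B : Set (ℝ × ℝ)}

/-- The upper endpoint of the window, together with the local structure of the region at the
lower endpoint in case the latter is the given visible point. -/
theorem exists_window_top (h : LocallyPolygonal R B)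
    (hreg : originVis R ⊆ closure (interior (originVis R))) (hy : (0, 1) ∈ originVis R)
    (hbd : ∀ τ₀ : ℝ, ∃ T ≥ τ₀, (0, T) ∉ R) {t₁ : ℝ} (ht₁ : 0 < t₁)
    (hs : ∀ t, 0 < t → t < t₁ → (t, 1) ∈ R ∧ (t, 1) ∉ originVis R)
    {c : ℝ} (hc0 : 0 ≤ c) (hc1 : c ≤ 1) (hc : (0, c) ∈ closure (blockers R))
    (hlast : ∀ τ, c < τ → τ ≤ 1 → (0, τ) ∉ closure (blockers R)) :
    ∃ b, 1 ≤ b ∧ c < b ∧ (0, b) ∈ frontier R ∧ (∀ τ, c < τ → τ < b → (0, τ) ∈ interior R) ∧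
      (c = 1 → ∀ᶠ q : ℝ × ℝ in nhds (0, 1), 0 < q.1 → 1 ≤ q.2 → (q.2 * q.1, q.2) ∈ R) := by
  have hax := (axis_mem_originVis_iff zero_le_one).1 hy
  rcases hc1.eq_or_lt with rfl | hc1
  · have hq : ∀ ε > 0, ∃ a b : ℝ, 0 < a ∧ a < ε ∧ 0 < b ∧ b < ε ∧
        ((0, 1) : ℝ × ℝ) + (a, -b) ∉ R := by
      intro ε hε
      have hcont : Filter.Tendsto (fun q : ℝ × ℝ => q.2 * q.1) (nhds (0, 1)) (nhds 0) := by
        have : Continuous fun q : ℝ × ℝ => q.2 * q.1 := by fun_prop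
        simpa using this.tendsto (0, 1)
      obtain ⟨q, ⟨q1, q2⟩, hq⟩ := mem_closure_iff_nhds.1 hc _
        ((hcont.eventually (gt_mem_nhds hε)).and
          ((continuous_snd.tendsto ((0, 1) : ℝ × ℝ)).eventually
          (lt_mem_nhds (show 1 - ε < 1 by linarith))))
      refine ⟨q.2 * q.1, 1 - q.2, mul_pos hq.2.1 hq.1, q1, by linarith [hq.2.2.1], by linarith, ?_⟩
      simpa using hq.2.2.2
    obtain ⟨ρ, hρ, H⟩ := h.opposite_corner_subset (p := (0, 1))
      (closure_mono (interior_mono originVis_subset) (hreg hy)) ht₁ one_pos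
      (fun t h1 h2 => by simpa using (hs t h1 h2).1)
      (fun t h1 h2 => by simpa using hax (1 + -t) (by linarith) (by linarith)) hq
    have hint : ∀ β, 0 < β → β < ρ → ((0, 1 + β) : ℝ × ℝ) ∈ interior R := by
      intro β h1 h2
      have hU : IsOpen {q : ℝ × ℝ | |q.1| < ρ ∧ |q.2 - 1| < ρ ∧ 0 < q.2 - 1} :=
        (isOpen_lt continuous_fst.abs continuous_const).inter
          ((isOpen_lt (continuous_snd.sub continuous_const).abs continuous_const).inter
            (isOpen_lt continuous_const (continuous_snd.sub continuous_const)))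
      refine interior_maximal ?_ hU ?_
      · rintro ⟨x, y⟩ ⟨e1, e2, e3⟩
        simpa using H x (y - 1) e1 e2 (Or.inl e3)
      · simp [abs_of_pos h1, hρ, h2, h1]
    obtain ⟨T, hT, hout⟩ := hbd (1 + ρ / 2)
    obtain ⟨b, hb, hbf, hbi⟩ := exists_next_frontier h.isClosed_region hT
      (interior_subset (hint (ρ / 2) (by positivity) (by linarith))) hout
    refine ⟨b, by linarith, by linarith, hbf, fun τ h1 h2 => ?_, fun _ => ?_⟩
    · rcases lt_or_ge τ (1 + ρ / 2) with h3 | h3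
      · have := hint (τ - 1) (by linarith) (by linarith)
        simpa using this
      · exact hbi τ h3 h2
    · have e1 : Filter.Tendsto (fun q : ℝ × ℝ => q.2 * q.1) (nhds (0, 1)) (nhds 0) := by
        have : Continuous fun q : ℝ × ℝ => q.2 * q.1 := by fun_prop
        simpa using this.tendsto (0, 1)
      have e2 := e1.eventually (gt_mem_nhds (lt_min hρ ht₁))
      have e3 := (continuous_snd.tendsto ((0, 1) : ℝ × ℝ)).eventually
        (gt_mem_nhds (show 1 < 1 + ρ by linarith))
      filter_upwards [e2, e3] with q h1 h2 h3 h4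
      rw [lt_min_iff] at h1
      have hpos : 0 < q.2 * q.1 := mul_pos (by linarith) h3
      rcases h4.eq_or_lt with h4 | h4
      · have := (hs _ hpos h1.2).1
        rw [← h4] at this ⊢
        exact this
      · have := H (q.2 * q.1) (q.2 - 1) (by rw [abs_of_pos hpos]; exact h1.1)
          (by rw [abs_of_pos (by linarith)]; linarith) (Or.inl (by linarith))
        simpa using this
  · obtain ⟨T, hT, hout⟩ := hbd 1
    obtain ⟨b, hb, hbf, hbi⟩ := exists_next_frontier h.isClosed_region hT
      (hax 1 zero_le_one le_rfl) hout
    refine ⟨b, hb, by linarith, hbf, fun τ h1 h2 => ?_, fun h => absurd h hc1.ne⟩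
    rcases lt_or_ge τ 1 with h3 | h3
    · exact h.mem_interior_of_not_blocked hreg hy hc0 hc hlast h1 h3
    · exact hbi τ h3 h2

/-- A visible point that is accessible from hidden points lies on a window which is contained in
the closure of the component of those hidden points, in coordinates where the viewpoint is the
origin, the visible point is `(0, 1)` and the hidden points are `(t, 1)`. -/
theorem exists_window_coord (h : LocallyPolygonal R B)
    (hreg : originVis R ⊆ closure (interior (originVis R))) (hy : (0, 1) ∈ originVis R)
    (hbd : ∀ τ₀ : ℝ, ∃ T ≥ τ₀, (0, T) ∉ R) {t₁ : ℝ} (ht₁ : 0 < t₁)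
    (hs : ∀ t, 0 < t → t < t₁ → (t, 1) ∈ R ∧ (t, 1) ∉ originVis R)
    {O : Set (ℝ × ℝ)} (hO : IsOpen O) (hVO : originVis R ⊆ O) :
    ∃ c b t₀, c < b ∧ c ≤ 1 ∧ 1 ≤ b ∧ 0 < t₀ ∧ t₀ < t₁ ∧ (t₀, 1) ∈ O ∧
      (0, c) ∈ frontier R ∧ (0, b) ∈ frontier R ∧
      (∀ τ, c < τ → τ < b → (0, τ) ∈ interior R) ∧ ∀ τ ∈ Icc c b, (0, τ) ∈ originVis R ∧
        (0, τ) ∈ closure (connectedComponentIn (O ∩ (R \ originVis R)) (t₀, 1)) := by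
  have hax := (axis_mem_originVis_iff zero_le_one).1 hy
  have hRc := h.isClosed_region
  obtain ⟨c, hc0, hc1, hc, hlast⟩ := exists_last_blocked (hax 0 le_rfl zero_le_one) ht₁ hs
  obtain ⟨b, hb1, hcb, hbf, hint, hcorner⟩ :=
    h.exists_window_top hreg hy hbd ht₁ hs hc0 hc1 hc hlast
  have hvis : ∀ τ, 0 ≤ τ → τ ≤ b → (0, τ) ∈ originVis R := by
    intro τ h0 h1
    rw [axis_mem_originVis_iff h0]
    intro τ' h0' h1'
    rcases le_or_gt τ' 1 with h2 | h2
    · exact hax τ' h0' h2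
    rcases (h1'.trans h1).eq_or_lt with rfl | h3
    · exact hRc.frontier_subset hbf
    · exact interior_subset (hint τ' (by linarith) h3)
  have hψ : Continuous fun q : ℝ × ℝ => (q.2 * q.1, q.2) := by fun_prop
  obtain ⟨t₀, ht₀, ht₀1, hO₀⟩ : ∃ t₀, 0 < t₀ ∧ t₀ < t₁ ∧ ∀ t, 0 < t → t ≤ t₀ → (t, 1) ∈ O := by
    have hcO : ∀ᶠ t : ℝ in nhds 0, ((t, 1) : ℝ × ℝ) ∈ O :=
      (hO.preimage (by fun_prop : Continuous fun t : ℝ => (t, (1 : ℝ)))).mem_nhds (hVO hy)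
    obtain ⟨ε, hε, H⟩ := Metric.eventually_nhds_iff.1 hcO
    obtain ⟨t₀, h1, h2⟩ := exists_between (lt_min hε ht₁)
    rw [lt_min_iff] at h2
    exact ⟨t₀, h1, h2.2, fun t a1 a2 => H (by simp [abs_of_pos a1]; linarith)⟩
  have hM : ∀ t, 0 < t → t ≤ t₀ → (t, 1) ∈ O ∩ (R \ originVis R) := fun t h1 h2 =>
    ⟨hO₀ t h1 h2, hs t h1 (by linarith)⟩
  have hfc : (0, c) ∈ frontier R := by
    rw [frontier_eq_closure_inter_closure]
    exact ⟨subset_closure (hax c hc0 hc1), mem_closure_compl_of_blocked hc⟩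
  have hmain : ∀ τ ∈ Ioo c b,
      (0, τ) ∈ closure (connectedComponentIn (O ∩ (R \ originVis R)) (t₀, 1)) := by
    rintro τ ⟨hτ1, hτ2⟩
    refine mem_closure_connectedComponentIn (min_le_right τ 1) (le_max_right τ 1) ?_ ht₀ hM
      ⟨min_le_left _ _, le_max_left _ _⟩
    obtain ⟨σ₀, hσ₀, hhid⟩ := h.exists_hidden_of_blocked hc0 hc (τ₁ := min τ 1)
      (le_min hτ1.le hc1) (by
        rcases le_or_gt 1 τ with h1 | h1
        · exact Or.inr (le_min h1 le_rfl)
        · exact Or.inl (by rwa [min_eq_left h1.le]))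
    rintro τ' ⟨h1, h2⟩
    have hτ'0 : 0 ≤ τ' := hc0.trans ((le_min hτ1.le hc1).trans h1)
    have hτ'b : τ' ≤ b := h2.trans (max_le hτ2.le hb1)
    have evO : ∀ᶠ q : ℝ × ℝ in nhds (0, τ'), (q.2 * q.1, q.2) ∈ O :=
      (hO.preimage hψ).mem_nhds (by simpa using hVO (hvis τ' hτ'0 hτ'b))
    have evσ : ∀ᶠ q : ℝ × ℝ in nhds (0, τ'), q.1 < σ₀ :=
      (continuous_fst.tendsto ((0, τ') : ℝ × ℝ)).eventually (gt_mem_nhds hσ₀)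
    have evI : (0, τ') ∈ interior R → ∀ᶠ q : ℝ × ℝ in nhds (0, τ'), (q.2 * q.1, q.2) ∈ R :=
      fun hi => by
        filter_upwards [(isOpen_interior.preimage hψ).mem_nhds
          (show (0, τ') ∈ (fun q : ℝ × ℝ => (q.2 * q.1, q.2)) ⁻¹' interior R by simpa using hi)]
          with q hq using interior_subset hq
    have evB : c < τ' → τ' ≤ 1 → ∀ᶠ q : ℝ × ℝ in nhds (0, τ'), q ∉ blockers R := fun a1 a2 => by
      filter_upwards [isClosed_closure.isOpen_compl.mem_nhds (hlast τ' a1 a2)] with q hq hq'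
      exact hq (subset_closure hq')
    have evR : ∀ᶠ q : ℝ × ℝ in nhds (0, τ'), 0 < q.1 → q.2 ∈ Icc (min τ 1) (max τ 1) →
        (q.2 * q.1, q.2) ∈ R := by
      rcases lt_trichotomy τ' 1 with h3 | h3 | h3
      · have hττ' : τ ≤ τ' := by
          rcases min_le_iff.1 h1 with h | h
          · exact h
          · linarith
        filter_upwards [evB (by linarith) h3.le,
          (continuous_snd.tendsto ((0, τ') : ℝ × ℝ)).eventually (gt_mem_nhds h3),
          (continuous_snd.tendsto ((0, τ') : ℝ × ℝ)).eventually
            (lt_mem_nhds (show 0 < τ' by linarith))] with q e1 e2 e3 e4 _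
        by_contra hout
        exact e1 ⟨e4, e3, e2, hout⟩
      · subst h3
        rcases le_or_gt τ 1 with h4 | h4
        · filter_upwards [evB (by linarith) le_rfl,
            (continuous_snd.tendsto ((0, 1) : ℝ × ℝ)).eventually (lt_mem_nhds zero_lt_one),
            (continuous_fst.tendsto ((0, 1) : ℝ × ℝ)).eventually (gt_mem_nhds ht₁)]
            with q e1 e2 e3 e4 e5
          rw [max_eq_right h4] at e5
          rcases e5.2.eq_or_lt with h5 | h5
          · rw [h5, one_mul]; exact (hs _ e4 e3).1
          · by_contra hout
            exact e1 ⟨e4, e2, h5, hout⟩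
        · rcases hc1.eq_or_lt with h5 | h5
          · filter_upwards [hcorner h5] with q e1 e2 e3
            exact e1 e2 (by rw [min_eq_right h4.le] at e3; exact e3.1)
          · filter_upwards [evI (hint 1 h5 (by linarith))] with q e1 _ _ using e1
      · have hττ' : τ' ≤ τ := by
          rcases le_max_iff.1 h2 with h | h
          · exact h
          · linarith
        filter_upwards [evI (hint τ' (by linarith) (by linarith))] with q e1 _ _ using e1
    filter_upwards [evO, evσ, evR] with q e1 e2 e3 e4 e5
    exact ⟨e1, e3 e4 e5, hhid q.1 e4 e2 q.2 e5.1⟩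
  refine ⟨c, b, t₀, hcb, hc1, hb1, ht₀, ht₀1, hO₀ t₀ ht₀ le_rfl, hfc, hbf, hint, fun τ hτ =>
    ⟨hvis τ (hc0.trans hτ.1) hτ.2, ?_⟩⟩
  have hcl : τ ∈ closure (Ioo c b) := by rwa [closure_Ioo hcb.ne]
  have := map_mem_closure (f := fun σ : ℝ => ((0, σ) : ℝ × ℝ)) (by fun_prop) hcl hmain
  rwa [closure_closure] at this

end Coordinates

end LocallyPolygonal

section Segment

variable {E : Type*} [NormedAddCommGroup E] [NormedSpace ℝ E]

theorem isCompact_segment_of_real (a b : E) : IsCompact (segment ℝ a b) := by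
  rw [segment_eq_image_lineMap]
  exact isCompact_Icc.image (by fun_prop)

theorem exists_radius_of_notMem_segment {a b p : E} (hp : p ∉ segment ℝ a b) :
    ∃ r > 0, ∀ u : E, ‖u‖ < r → p + u ∉ segment ℝ a b := by
  obtain ⟨r, hr, H⟩ :=
    Metric.isOpen_iff.1 (isCompact_segment_of_real a b).isClosed.isOpen_compl p hp
  exact ⟨r, hr, fun u hu => H (by simpa using hu)⟩

theorem segment_cone (a b p : E) : ∃ r > 0, ∀ u : E, ‖u‖ < r → ∀ t : ℝ, 0 < t → t ≤ 1 →
    p + t • u ∈ segment ℝ a b → p + u ∈ segment ℝ a b := by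
  by_cases hp : p ∈ segment ℝ a b
  swap
  · obtain ⟨r, hr, H⟩ := exists_radius_of_notMem_segment hp
    refine ⟨r, hr, fun u hu t ht ht1 h => absurd h (H _ ?_)⟩
    rw [norm_smul, Real.norm_of_nonneg ht.le]
    nlinarith [norm_nonneg u]
  rcases eq_or_ne a b with rfl | hab
  · refine ⟨1, one_pos, fun u _ t ht _ h => ?_⟩
    simp only [segment_same, mem_singleton_iff] at hp h ⊢
    subst hp
    have h' : t • u = 0 := by simpa using h
    rcases smul_eq_zero.1 h' with h' | h'
    · exact absurd h' ht.ne'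
    · simp [h']
  rw [segment_eq_image'] at hp ⊢
  obtain ⟨θ, ⟨h0, h1⟩, rfl⟩ := hp
  have hn : 0 < ‖b - a‖ := norm_pos_iff.2 (sub_ne_zero.2 hab.symm)
  have hr : ∃ r > 0, (0 < θ → r ≤ θ) ∧ (θ < 1 → r ≤ 1 - θ) := by
    rcases h0.eq_or_lt with h0 | h0
    · exact ⟨1, one_pos, fun h => by linarith, fun h => by linarith⟩
    rcases h1.eq_or_lt with h1 | h1
    · exact ⟨1, one_pos, fun h => by linarith, fun h => by linarith⟩
    · exact ⟨min θ (1 - θ), lt_min h0 (by linarith), fun _ => min_le_left _ _,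
        fun _ => min_le_right _ _⟩
  obtain ⟨r, hr, hr0, hr1⟩ := hr
  refine ⟨r * ‖b - a‖, by positivity, fun u hu t ht ht1 h => ?_⟩
  obtain ⟨θ', ⟨h0', h1'⟩, he⟩ := h
  have hu' : u = ((θ' - θ) / t) • (b - a) := by
    have : t • u = (θ' - θ) • (b - a) := by
      have he' : a + θ' • (b - a) = a + θ • (b - a) + t • u := he
      rw [add_assoc] at he'
      rw [sub_smul, add_left_cancel he']
      abel
    rw [div_eq_inv_mul, mul_smul, ← this, inv_smul_smul₀ ht.ne']
  set k := (θ' - θ) / t with hk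
  have hkt : θ' - θ = k * t := by rw [hk]; field_simp
  have hkr : |k| < r := by
    rw [hu', norm_smul, Real.norm_eq_abs] at hu
    exact lt_of_mul_lt_mul_right hu hn.le
  obtain ⟨hk1, hk2⟩ := abs_lt.1 hkr
  refine ⟨θ + k, ⟨?_, ?_⟩, by simp only [hu']; module⟩
  · rcases h0.eq_or_lt with h0 | h0
    · have : 0 ≤ k := by rw [hk]; exact div_nonneg (by linarith) ht.le
      linarith
    · linarith [hr0 h0]
  · rcases h1.eq_or_lt with h1 | h1
    · have : k ≤ 0 := by rw [hk]; exact div_nonpos_of_nonpos_of_nonneg (by linarith) ht.le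
      linarith
    · linarith [hr1 h1]

theorem sameRay_of_add_mem_segment {a b u₁ u₂ : E} (h₁ : a + u₁ ∈ segment ℝ a b)
    (h₂ : a + u₂ ∈ segment ℝ a b) : SameRay ℝ u₁ u₂ := by
  rw [segment_eq_image'] at h₁ h₂
  obtain ⟨θ₁, h₁, e₁⟩ := h₁
  obtain ⟨θ₂, h₂, e₂⟩ := h₂
  rw [← add_left_cancel e₁, ← add_left_cancel e₂]
  exact ((SameRay.refl _).nonneg_smul_left h₁.1).nonneg_smul_right h₂.1

theorem sameRay_of_three_mem_segment {a b p u₁ u₂ u₃ : E} (hp : p ∈ segment ℝ a b)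
    (h₁ : p + u₁ ∈ segment ℝ a b)
    (h₂ : p + u₂ ∈ segment ℝ a b) (h₃ : p + u₃ ∈ segment ℝ a b) :
    SameRay ℝ u₁ u₂ ∨ SameRay ℝ u₂ u₃ ∨ SameRay ℝ u₁ u₃ := by
  rw [segment_eq_image'] at hp
  obtain ⟨θ, -, rfl⟩ := hp
  have key : ∀ u, a + θ • (b - a) + u ∈ segment ℝ a b → ∃ k : ℝ, u = k • (b - a) := by
    intro u hu
    rw [segment_eq_image'] at hu
    obtain ⟨θ', -, e⟩ := hu
    refine ⟨θ' - θ, ?_⟩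
    have e' : a + θ' • (b - a) = a + θ • (b - a) + u := e
    rw [add_assoc] at e'
    rw [sub_smul, add_left_cancel e']
    abel
  obtain ⟨k₁, rfl⟩ := key _ h₁
  obtain ⟨k₂, rfl⟩ := key _ h₂
  obtain ⟨k₃, rfl⟩ := key _ h₃
  have pos : ∀ k l : ℝ, 0 ≤ k → 0 ≤ l → SameRay ℝ (k • (b - a)) (l • (b - a)) := fun k l hk hl =>
    ((SameRay.refl _).nonneg_smul_left hk).nonneg_smul_right hl
  have neg : ∀ k l : ℝ, k ≤ 0 → l ≤ 0 → SameRay ℝ (k • (b - a)) (l • (b - a)) := by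
    intro k l hk hl
    have := ((SameRay.refl (R := ℝ) (a - b)).nonneg_smul_left (neg_nonneg.2 hk)).nonneg_smul_right
      (neg_nonneg.2 hl)
    simpa only [← neg_sub b a, neg_smul_neg] using this
  rcases le_total 0 k₁ with a₁ | a₁ <;> rcases le_total 0 k₂ with a₂ | a₂ <;>
    rcases le_total 0 k₃ with a₃ | a₃
  all_goals first
    | exact Or.inl (pos _ _ (by assumption) (by assumption))
    | exact Or.inl (neg _ _ (by assumption) (by assumption))
    | exact Or.inr (Or.inl (pos _ _ (by assumption) (by assumption)))
    | exact Or.inr (Or.inl (neg _ _ (by assumption) (by assumption)))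
    | exact Or.inr (Or.inr (pos _ _ (by assumption) (by assumption)))
    | exact Or.inr (Or.inr (neg _ _ (by assumption) (by assumption)))

end Segment

theorem exists_pos_forall_of_finset {ι : Type*} {Q : ι → ℝ → Prop}
    (hQ : ∀ i r r', 0 < r' → r' ≤ r → Q i r → Q i r') (s : Finset ι) (h : ∀ i ∈ s, ∃ r > 0, Q i r) :
    ∃ r > 0, ∀ i ∈ s, Q i r := by
  classical
  induction s using Finset.induction_on with
  | empty => exact ⟨1, one_pos, by simp⟩
  | insert i s hi ih =>
    obtain ⟨r, hr, H⟩ := ih fun j hj => h j (Finset.mem_insert_of_mem hj)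
    obtain ⟨r', hr', H'⟩ := h i (Finset.mem_insert_self i s)
    refine ⟨min r r', lt_min hr hr', fun j hj => ?_⟩
    rcases Finset.mem_insert.1 hj with rfl | hj
    · exact hQ _ _ _ (lt_min hr hr') (min_le_right _ _) H'
    · exact hQ _ _ _ (lt_min hr hr') (min_le_left _ _) (H j hj)

namespace SimplePolygon

variable (P : SimplePolygon)

/-- The `i`-th edge. -/
def edge (i : ℕ) : Set Plane := segment ℝ (P.vertex i) (P.vertex (i + 1))

variable {P}

theorem mem_boundary_iff {x : Plane} : x ∈ P.boundary ↔ ∃ i < P.n, x ∈ P.edge i := by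
  simp [boundary, edge]

theorem vertex_mod (i : ℕ) : P.vertex (i % P.n) = P.vertex i :=
  Function.Periodic.map_mod_nat (f := P.vertex) P.periodic i

theorem eq_vertex_of_mem_edges {i j : ℕ} (hi : i < P.n) (hj : j < P.n) (hij : i ≠ j) {p : Plane}
    (hpi : p ∈ P.edge i) (hpj : p ∈ P.edge j) : p = P.vertex i ∨ p = P.vertex (i + 1) := by
  have h : p ∈ P.edge i ∩ P.edge j := ⟨hpi, hpj⟩
  rw [edge, edge, P.jordan i hi j hj hij] at h
  split_ifs at h with h1 h2
  · exact Or.inr h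
  · left
    rw [h2, vertex_mod]
    exact h
  · exact absurd h (notMem_empty p)

theorem sameRay_of_mem_edge {i : ℕ} {p u₁ u₂ : Plane}
    (hp : p = P.vertex i ∨ p = P.vertex (i + 1)) (h₁ : p + u₁ ∈ P.edge i)
    (h₂ : p + u₂ ∈ P.edge i) : SameRay ℝ u₁ u₂ := by
  rcases hp with rfl | rfl
  · exact sameRay_of_add_mem_segment h₁ h₂
  · rw [edge, segment_symm] at h₁ h₂
    exact sameRay_of_add_mem_segment h₁ h₂

theorem eq_of_vertex_eq {i j : ℕ} (hi : i < P.n) (hj : j < P.n)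
    (h : P.vertex i = P.vertex j ∨ P.vertex (i + 1) = P.vertex (j + 1)) : i = j := by
  rcases h with h | h
  · exact P.inj i hi j hj h
  · have hn : 0 < P.n := by have := P.three_le; omega
    rw [← vertex_mod (i + 1), ← vertex_mod (j + 1)] at h
    have := P.inj _ (Nat.mod_lt _ hn) _ (Nat.mod_lt _ hn) h
    exact Nat.ModEq.eq_of_lt_of_lt (Nat.ModEq.add_right_cancel' 1 this) hi hj

theorem isCompact_boundary : IsCompact P.boundary :=
  Finset.isCompact_biUnion _ fun _ _ => isCompact_segment_of_real _ _

theorem mem_region_iff_of_notMem_boundary {x : Plane} (hx : x ∉ P.boundary) :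
    x ∈ P.region ↔ Bornology.IsBounded (connectedComponentIn P.boundaryᶜ x) := by
  simp [region, hx]

theorem boundary_subset_region : P.boundary ⊆ P.region := subset_union_left

theorem mem_region_iff_of_mem_component {x y : Plane} (hx : x ∈ P.boundaryᶜ)
    (hy : y ∈ connectedComponentIn P.boundaryᶜ x) : y ∈ P.region ↔ x ∈ P.region := by
  rw [mem_region_iff_of_notMem_boundary hx,
    mem_region_iff_of_notMem_boundary (connectedComponentIn_subset _ _ hy),
    connectedComponentIn_eq hy]

theorem isClosed_region : IsClosed P.region := by
  rw [← isOpen_compl_iff, isOpen_iff_mem_nhds]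
  intro x hx
  have hxb : x ∈ P.boundaryᶜ := fun h => hx (boundary_subset_region h)
  have ho : IsOpen (connectedComponentIn P.boundaryᶜ x) :=
    isCompact_boundary.isClosed.isOpen_compl.connectedComponentIn
  filter_upwards [ho.mem_nhds (mem_connectedComponentIn hxb)] with y hy
  exact fun h => hx ((mem_region_iff_of_mem_component hxb hy).1 h)

theorem isBounded_region : Bornology.IsBounded P.region := by
  obtain ⟨K, hK, hb⟩ := isCompact_boundary (P := P).isBounded.exists_pos_norm_le
  refine isBounded_iff_forall_norm_le.2 ⟨K, fun x hx => ?_⟩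
  by_contra! hxK
  have hray : ∀ t : ℝ, 1 ≤ t → t • x ∈ P.boundaryᶜ := by
    intro t ht h
    have := hb _ h
    rw [norm_smul, Real.norm_of_nonneg (by linarith)] at this
    nlinarith
  have hxb : x ∉ P.boundary := by simpa using hray 1 le_rfl
  rw [mem_region_iff_of_notMem_boundary hxb] at hx
  have hsub : (fun t : ℝ => t • x) '' Ici 1 ⊆ connectedComponentIn P.boundaryᶜ x := by
    refine IsPreconnected.subset_connectedComponentIn
      (isPreconnected_Ici.image _ (by fun_prop)) ⟨1, self_mem_Ici, by simp⟩ ?_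
    rintro _ ⟨t, ht, rfl⟩
    exact hray t ht
  obtain ⟨M, hM⟩ := isBounded_iff_forall_norm_le.1 (hx.subset hsub)
  have h1 := hM _ ⟨max 1 (M / K + 1), mem_Ici.2 (le_max_left _ _), rfl⟩
  rw [norm_smul, Real.norm_of_nonneg (by positivity)] at h1
  have h2 : M / K + 1 ≤ max 1 (M / K + 1) := le_max_right _ _
  have h3 : (M / K + 1) * K = M + K := by field_simp
  have h4 : 0 ≤ max 1 (M / K + 1) := by positivity
  nlinarith

theorem locallyPolygonal : LocallyPolygonal P.region P.boundary where
  isClosed_region := isClosed_region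
  isClosed_boundary := isCompact_boundary.isClosed
  boundary_subset := boundary_subset_region
  subset_or_disjoint S hS hSB := by
    by_cases h : Disjoint S P.region
    · exact Or.inr h
    obtain ⟨x, hxS, hxR⟩ := Set.not_disjoint_iff.1 h
    have hsub := hS.subset_connectedComponentIn hxS (disjoint_left.1 hSB)
    exact Or.inl fun y hy => (mem_region_iff_of_mem_component
      (disjoint_left.1 hSB hxS) (hsub hy)).2 hxR
  cone p := by
    obtain ⟨r, hr, H⟩ := exists_pos_forall_of_finset (s := Finset.range P.n)
      (Q := fun i r => ∀ u : Plane, ‖u‖ < r → ∀ t : ℝ, 0 < t → t ≤ 1 →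
        p + t • u ∈ P.edge i → p + u ∈ P.edge i)
      (fun i r r' _ h H u hu => H u (hu.trans_le h)) (fun i _ => segment_cone _ _ _)
    refine ⟨r, hr, fun u hu t ht ht1 h => ?_⟩
    obtain ⟨i, hi, h⟩ := mem_boundary_iff.1 h
    exact mem_boundary_iff.2 ⟨i, hi, H i (Finset.mem_range.2 hi) u hu t ht ht1 h⟩
  two_rays p := by
    obtain ⟨r, hr, H⟩ := exists_pos_forall_of_finset (s := Finset.range P.n)
      (Q := fun i r => ∀ u : Plane, ‖u‖ < r → p + u ∈ P.edge i → p ∈ P.edge i)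
      (fun i r r' _ h H u hu => H u (hu.trans_le h)) (fun i _ => by
        by_cases hp : p ∈ P.edge i
        · exact ⟨1, one_pos, fun _ _ _ => hp⟩
        · obtain ⟨r, hr, H⟩ := exists_radius_of_notMem_segment hp
          exact ⟨r, hr, fun u hu h => absurd h (H u hu)⟩)
    refine ⟨r, hr, fun u₁ u₂ u₃ _ _ _ hr₁ hr₂ hr₃ h₁ h₂ h₃ => ?_⟩
    obtain ⟨i, hi, h₁⟩ := mem_boundary_iff.1 h₁
    obtain ⟨j, hj, h₂⟩ := mem_boundary_iff.1 h₂
    obtain ⟨k, hk, h₃⟩ := mem_boundary_iff.1 h₃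
    have pi := H i (Finset.mem_range.2 hi) _ hr₁ h₁
    have pj := H j (Finset.mem_range.2 hj) _ hr₂ h₂
    have pk := H k (Finset.mem_range.2 hk) _ hr₃ h₃
    by_cases hall : i = j ∧ j = k
    · obtain ⟨rfl, rfl⟩ := hall
      exact sameRay_of_three_mem_segment pi h₁ h₂ h₃
    have ei : p = P.vertex i ∨ p = P.vertex (i + 1) := by
      by_cases hij : i = j
      · exact eq_vertex_of_mem_edges hi hk (fun h => hall ⟨hij, by omega⟩) pi pk
      · exact eq_vertex_of_mem_edges hi hj hij pi pj
    have ej : p = P.vertex j ∨ p = P.vertex (j + 1) := by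
      by_cases hij : i = j
      · exact hij ▸ ei
      · exact eq_vertex_of_mem_edges hj hi (Ne.symm hij) pj pi
    have ek : p = P.vertex k ∨ p = P.vertex (k + 1) := by
      by_cases hjk : j = k
      · exact hjk ▸ ej
      · exact eq_vertex_of_mem_edges hk hj (Ne.symm hjk) pk pj
    have hpig : i = j ∨ j = k ∨ i = k := by
      have hij := eq_of_vertex_eq hi hj
      have hjk := eq_of_vertex_eq hj hk
      have hik := eq_of_vertex_eq hi hk
      rcases ei with ei | ei <;> rcases ej with ej | ej <;> rcases ek with ek | ek <;> grind
    rcases hpig with rfl | rfl | rfl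
    · exact Or.inl (sameRay_of_mem_edge ei h₁ h₂)
    · exact Or.inr (Or.inl (sameRay_of_mem_edge ej h₂ h₃))
    · exact Or.inr (Or.inr (sameRay_of_mem_edge ei h₁ h₃))

theorem mem_Vis_iff {p q : Plane} : q ∈ P.Vis p ↔ segment ℝ p q ⊆ P.region :=
  ⟨fun h => h.2, fun h => ⟨h (right_mem_segment ℝ p q), h⟩⟩

theorem mem_Vis_iff_forall {p q : Plane} :
    q ∈ P.Vis p ↔ ∀ θ : ℝ, 0 ≤ θ → θ ≤ 1 → p + θ • (q - p) ∈ P.region := by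
  rw [mem_Vis_iff, segment_eq_image', image_subset_iff]
  exact ⟨fun h θ h0 h1 => h ⟨h0, h1⟩, fun h θ hθ => h θ hθ.1 hθ.2⟩

theorem mem_Vis_comm {p q : Plane} : q ∈ P.Vis p ↔ p ∈ P.Vis q := by
  rw [mem_Vis_iff, mem_Vis_iff, segment_symm]

theorem self_mem_Vis {p : Plane} (hp : p ∈ P.region) : p ∈ P.Vis p := by
  rw [mem_Vis_iff, segment_same]
  exact singleton_subset_iff.2 hp

theorem isClosed_Vis (p : Plane) : IsClosed (P.Vis p) := by
  have : P.Vis p = ⋂ θ ∈ Icc (0 : ℝ) 1, (fun q => p + θ • (q - p)) ⁻¹' P.region := by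
    ext q
    simp [mem_Vis_iff_forall]
  rw [this]
  exact isClosed_biInter fun θ _ => isClosed_region.preimage (by fun_prop)

theorem segment_subset_Vis {p q : Plane} (h : q ∈ P.Vis p) : segment ℝ p q ⊆ P.Vis p :=
  fun _ hx => mem_Vis_iff.2 (((convex_segment p q).segment_subset
    (left_mem_segment ℝ p q) hx).trans (mem_Vis_iff.1 h))

/-- Hidden points approach a visible point in a direction transverse to the line of sight. -/
theorem linearIndependent_of_hidden {v y s : Plane} (hy : y ∈ P.Vis v) {t₁ : ℝ} (ht₁ : 0 < t₁)
    (hs : ∀ t : ℝ, 0 < t → t < t₁ → y + t • s ∈ P.region \ P.Vis v) {α β : ℝ}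
    (h : α • s + β • (y - v) = 0) : α = 0 ∧ β = 0 := by
  have hd : y - v ≠ 0 := by
    intro hd
    refine (hs (t₁ / 2) (by linarith) (by linarith)).2 (mem_Vis_iff_forall.2 fun θ h0 h1 => ?_)
    obtain rfl := sub_eq_zero.1 hd
    rcases h0.eq_or_lt with rfl | h0
    · simpa using hy.1
    · convert (hs (θ * (t₁ / 2)) (by positivity) (by nlinarith)).1 using 1
      module
  have hα : α = 0 := by
    by_contra hα
    obtain ⟨k, rfl⟩ : ∃ k : ℝ, s = k • (y - v) := by
      refine ⟨-(α⁻¹ * β), ?_⟩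
      rw [neg_smul, mul_smul, ← add_eq_zero_iff_eq_neg, ← smul_right_injective _ hα |>.eq_iff]
      simpa [smul_smul, mul_inv_cancel₀ hα, smul_add, mul_inv_cancel_left₀ hα] using h
    obtain ⟨t, ht0, ht1, htk⟩ : ∃ t : ℝ, 0 < t ∧ t < t₁ ∧ 0 ≤ 1 + t * k := by
      have hp : 0 < 1 + |k| := by positivity
      refine ⟨min (t₁ / 2) (1 / (1 + |k|)), lt_min (by linarith) (by positivity),
        (min_le_left _ _).trans_lt (by linarith), ?_⟩
      have h1 : min (t₁ / 2) (1 / (1 + |k|)) * (1 + |k|) ≤ 1 := by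
        rw [← le_div_iff₀ hp]
        exact min_le_right _ _
      have h2 : 0 < min (t₁ / 2) (1 / (1 + |k|)) := lt_min (by linarith) (by positivity)
      nlinarith [neg_abs_le k]
    refine (hs t ht0 ht1).2 (mem_Vis_iff_forall.2 fun θ h0 h1 => ?_)
    have e : v + θ • (y + t • k • (y - v) - v) = v + (θ * (1 + t * k)) • (y - v) := by module
    rw [e]
    rcases le_or_gt (θ * (1 + t * k)) 1 with hle | hlt
    · exact mem_Vis_iff_forall.1 hy _ (by positivity) hle
    · have hk : 0 < k := by
        by_contra! hk
        nlinarith [mul_nonneg ht0.le (neg_nonneg.2 hk), mul_nonneg h0 htk]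
      have hlt' : (θ * (1 + t * k) - 1) / k ≤ t := by
        rw [div_le_iff₀ hk]
        nlinarith
      convert (hs ((θ * (1 + t * k) - 1) / k) (div_pos (by linarith) hk) (hlt'.trans_lt ht1)).1
        using 1
      rw [smul_smul, div_mul_cancel₀ _ hk.ne']
      module
  subst hα
  refine ⟨rfl, ?_⟩
  simpa [hd] using h

theorem isWindow_of_subset_frontier {v a b : Plane} (hab : a ≠ b)
    (h : segment ℝ a b ⊆ frontier (P.Vis v))
    (h' : segment ℝ a b ∩ frontier P.region = {a, b}) : P.IsWindow v (segment ℝ a b) := by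
  refine ⟨a, b, hab, rfl, h, h', fun a' b' _ _ h2 h3 => ?_⟩
  have hsub : ({a, b} : Set Plane) ⊆ {a', b'} := by
    rw [← h', ← h2]
    exact inter_subset_inter_left _ h3
  have ha : a = a' ∨ a = b' := hsub (mem_insert _ _)
  have hb : b = a' ∨ b = b' := hsub (mem_insert_of_mem _ rfl)
  rcases ha with rfl | rfl <;> rcases hb with rfl | rfl
  · exact absurd rfl hab
  · rfl
  · exact segment_symm ℝ _ _
  · exact absurd rfl hab

/-- A visible point that is accessible from hidden points lies on a window which is contained in
the closure of the component of those hidden points. -/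
theorem exists_window {v y s : Plane} (hreg : P.VisRegular v) (hy : y ∈ P.Vis v) {t₁ : ℝ}
    (ht₁ : 0 < t₁) (hs : ∀ t : ℝ, 0 < t → t < t₁ → y + t • s ∈ P.region \ P.Vis v)
    {O : Set Plane} (hO : IsOpen O) (hVO : P.Vis v ⊆ O) :
    ∃ e, ∃ t₀ : ℝ, P.IsWindow v e ∧ y ∈ e ∧ 0 < t₀ ∧ t₀ < t₁ ∧ y + t₀ • s ∈ O ∧
      e ⊆ closure (connectedComponentIn (O ∩ (P.region \ P.Vis v)) (y + t₀ • s)) := by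
  let l : ℝ × ℝ →ₗ[ℝ] Plane :=
    (LinearMap.fst ℝ ℝ ℝ).smulRight s + (LinearMap.snd ℝ ℝ ℝ).smulRight (y - v)
  have hl : Function.Injective l := by
    refine (injective_iff_map_eq_zero l).2 fun q hq => ?_
    obtain ⟨h1, h2⟩ := linearIndependent_of_hidden hy ht₁ hs (α := q.1) (β := q.2) hq
    exact Prod.ext h1 h2
  let L : (ℝ × ℝ) ≃L[ℝ] Plane :=
    (LinearMap.linearEquivOfInjective l hl (by simp)).toContinuousLinearEquiv
  have hL : ∀ a b : ℝ, L (a, b) = a • s + b • (y - v) := fun a b => rfl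
  let Φ : ℝ × ℝ ≃ₜ Plane := L.toHomeomorph.trans (Homeomorph.addLeft v)
  have hΦ : ∀ q, Φ q = v + L q := fun q => rfl
  have hΦ' : ∀ a b : ℝ, Φ (a, b) = v + (a • s + b • (y - v)) := fun a b => rfl
  have hΦ1 : ∀ t : ℝ, Φ (t, 1) = y + t • s := fun t => by rw [hΦ']; module
  have hV : Φ ⁻¹' P.Vis v = originVis (Φ ⁻¹' P.region) := by
    ext q
    rw [mem_preimage, mem_Vis_iff_forall, originVis, mem_ofPred_eq, segment_eq_image',
      image_subset_iff]
    have e : ∀ θ : ℝ, Φ (0 + θ • (q - 0)) = v + θ • (Φ q - v) := fun θ => by simp [hΦ]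
    constructor
    · intro h θ hθ
      simpa only [mem_preimage, e] using h θ hθ.1 hθ.2
    · intro h θ h0 h1
      have := h ⟨h0, h1⟩
      simpa only [mem_preimage, e] using this
  have hd : y - v ≠ 0 := fun hd => by
    simpa using linearIndependent_of_hidden hy ht₁ hs (α := 0) (β := 1) (by simp [hd])
  have hbd : ∀ τ₀ : ℝ, ∃ T ≥ τ₀, ((0 : ℝ), T) ∉ Φ ⁻¹' P.region := by
    intro τ₀
    obtain ⟨K, hK⟩ := isBounded_iff_forall_norm_le.1 (isBounded_region (P := P))
    have hn : 0 < ‖y - v‖ := norm_pos_iff.2 hd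
    refine ⟨max (max τ₀ 0) ((K + ‖v‖ + 1) / ‖y - v‖), (le_max_left _ _).trans' (le_max_left _ _),
      fun h => ?_⟩
    set T := max (max τ₀ 0) ((K + ‖v‖ + 1) / ‖y - v‖)
    have hT0 : 0 ≤ T := (le_max_right _ _).trans (le_max_left _ _)
    have hT : K + ‖v‖ + 1 ≤ T * ‖y - v‖ := (div_le_iff₀ hn).1 (le_max_right _ _)
    have h1 : ‖v + T • (y - v)‖ ≤ K := by
      have := hK _ h
      rwa [hΦ', zero_smul, zero_add] at this
    have h2 : ‖T • (y - v)‖ ≤ ‖v + T • (y - v)‖ + ‖v‖ := by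
      simpa using norm_sub_le (v + T • (y - v)) v
    rw [norm_smul, Real.norm_of_nonneg hT0] at h2
    linarith
  obtain ⟨c, b, t₀, hcb, hc1, hb1, ht0, ht01, htO, hcf, hbf, hint, hcl⟩ :=
    (P.locallyPolygonal.preimage L v).exists_window_coord (t₁ := t₁) (O := Φ ⁻¹' O)
      (by
        change originVis (Φ ⁻¹' P.region) ⊆ closure (interior (originVis (Φ ⁻¹' P.region)))
        rw [← hV, ← Φ.preimage_interior, ← Φ.preimage_closure]
        exact preimage_mono hreg.subset)
      (by
        change _ ∈ originVis (Φ ⁻¹' P.region)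
        rw [← hV, mem_preimage, hΦ1, zero_smul, add_zero]
        exact hy)
      hbd ht₁
      (fun t h0 h1 => by
        change (t, (1 : ℝ)) ∈ Φ ⁻¹' P.region ∧ (t, (1 : ℝ)) ∉ originVis (Φ ⁻¹' P.region)
        rw [← hV, mem_preimage, mem_preimage, hΦ1]
        exact hs t h0 h1)
      (hO.preimage Φ.continuous)
      (by
        change originVis (Φ ⁻¹' P.region) ⊆ _
        rw [← hV]
        exact preimage_mono hVO)
  change (0, c) ∈ frontier (Φ ⁻¹' P.region) at hcf
  change (0, b) ∈ frontier (Φ ⁻¹' P.region) at hbf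
  rw [← Φ.preimage_frontier] at hcf hbf
  have hint' : ∀ τ, c < τ → τ < b → Φ (0, τ) ∈ interior P.region := by
    intro τ h1 h2
    have : (0, τ) ∈ interior (Φ ⁻¹' P.region) := hint τ h1 h2
    rwa [← Φ.preimage_interior] at this
  have htO' : y + t₀ • s ∈ O := by
    rw [← hΦ1]
    exact htO
  have hcl' : ∀ τ ∈ Icc c b, Φ (0, τ) ∈ P.Vis v ∧
      Φ (0, τ) ∈ closure (connectedComponentIn (O ∩ (P.region \ P.Vis v)) (y + t₀ • s)) := by
    intro τ hτ
    obtain ⟨h1, h2⟩ := hcl τ hτ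
    change _ ∈ originVis (Φ ⁻¹' P.region) at h1
    change _ ∈ closure (connectedComponentIn
      (Φ ⁻¹' O ∩ (Φ ⁻¹' P.region \ originVis (Φ ⁻¹' P.region)))
      (t₀, 1)) at h2
    rw [← hV] at h1 h2
    refine ⟨h1, ?_⟩
    have h3 := mem_image_of_mem Φ h2
    rw [Φ.image_closure, ← preimage_sdiff, ← preimage_inter, Φ.image_connectedComponentIn,
      image_preimage_eq _ Φ.surjective, hΦ1] at h3
    · exact h3
    · rw [mem_preimage, hΦ1]
      exact ⟨htO', hs t₀ ht0 ht01⟩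
  have hseg : segment ℝ (Φ (0, c)) (Φ (0, b)) = (fun τ => Φ (0, τ)) '' Icc c b := by
    rw [← segment_eq_Icc hcb.le]
    let A : ℝ →ᵃ[ℝ] Plane := AffineMap.lineMap v y
    have hA : (fun τ : ℝ => Φ (0, τ)) = A := by
      ext1 τ
      simp [A, hΦ', AffineMap.lineMap_apply, add_comm]
    rw [hA, image_segment, ← hA]
  have hne : Φ (0, c) ≠ Φ (0, b) := fun h => hcb.ne (congrArg Prod.snd (Φ.injective h))
  refine ⟨segment ℝ (Φ (0, c)) (Φ (0, b)), t₀, isWindow_of_subset_frontier hne ?_ ?_, ?_, ht0, ht01,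
    htO', ?_⟩
  · rw [hseg]
    rintro _ ⟨τ, hτ, rfl⟩
    obtain ⟨h1, h2⟩ := hcl' τ hτ
    rw [frontier_eq_closure_inter_closure]
    exact ⟨subset_closure h1, closure_mono
      ((connectedComponentIn_subset _ _).trans fun x hx => hx.2.2) h2⟩
  · apply Subset.antisymm
    · rw [hseg]
      rintro _ ⟨⟨τ, hτ, rfl⟩, hf⟩
      rcases hτ.1.eq_or_lt with rfl | h1
      · exact mem_insert _ _
      rcases hτ.2.eq_or_lt with rfl | h2
      · exact mem_insert_of_mem _ rfl
      · exact absurd (hint' τ h1 h2) hf.2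
    · rintro x (rfl | rfl)
      · exact ⟨left_mem_segment ℝ _ _, hcf⟩
      · exact ⟨right_mem_segment ℝ _ _, hbf⟩
  · rw [hseg]
    exact ⟨1, ⟨hc1, hb1⟩, by simp [hΦ1]⟩
  · rw [hseg]
    rintro _ ⟨τ, hτ, rfl⟩
    exact (hcl' τ hτ).2

/-- If no attachment window of a neighbor of `w` sees `w'`, then the visibility region of `w'`
avoids those of the other witnesses. -/
theorem disjoint_Vis_of_invisible_windows {W : Set Plane}
    (hW : P.IsWitnessSet W) (hreg : ∀ u ∈ W, P.VisRegular u)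
    {w : Plane} (hw : w ∈ W) {w' : Plane} (hw' : w' ∈ P.Vis w)
    (hcond : ∀ v : Plane, P.GConAdj W w v →
      ∀ NV : Set Plane, IsCompOf NV (P.NVis W) →
        P.Attached NV w → P.Attached NV v →
          ∀ e : Set Plane, P.IsWindow v e → e ⊆ closure NV →
            ∀ x ∈ e, ¬ P.Visible x w')
    {v₀ : Plane} (hv₀ : v₀ ∈ W) (hne₀ : v₀ ≠ w) : P.Vis w' ∩ P.Vis v₀ = ∅ := by
  obtain ⟨hfin, -, hdisj⟩ := hW
  rw [← not_nonempty_iff_eq_empty]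
  rintro ⟨z, hzw, hzv⟩
  let f : ℝ → Plane := fun t => w' + t • (z - w')
  have hf : Continuous f := by fun_prop
  have hfR : ∀ t, 0 ≤ t → t ≤ 1 → f t ∈ P.region := fun t h0 h1 => mem_Vis_iff_forall.1 hzw t h0 h1
  let U : Set Plane := ⋃ u ∈ W \ {w}, P.Vis u
  have hU : IsClosed U := hfin.sdiff.isClosed_biUnion fun u _ => isClosed_Vis u
  obtain ⟨tb, ⟨⟨htb0, htb1⟩, htbU⟩, htbmin⟩ :=
    (isCompact_Icc.inter_right (hU.preimage hf)).exists_isLeast (s := Icc 0 1 ∩ f ⁻¹' U)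
      ⟨1, ⟨zero_le_one, le_rfl⟩, mem_biUnion (x := v₀) ⟨hv₀, hne₀⟩ (by simpa [f] using hzv)⟩
  obtain ⟨ta, ⟨⟨hta0, htab⟩, htaw⟩, htamax⟩ :=
    (isCompact_Icc.inter_right ((isClosed_Vis w).preimage hf)).exists_isGreatest
      (s := Icc 0 tb ∩ f ⁻¹' P.Vis w) ⟨0, ⟨le_rfl, htb0⟩, by simpa [f] using hw'⟩
  obtain ⟨v, ⟨hvW, hvw⟩, hyv⟩ := mem_iUnion₂.1 htbU
  have hvw : v ≠ w := hvw
  have hlt : ta < tb := by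
    refine htab.lt_of_ne fun h => ?_
    have : f ta ∈ P.Vis w ∩ P.Vis v := ⟨htaw, h ▸ hyv⟩
    rw [hdisj w hw v hvW hvw.symm] at this
    exact this
  have hnv : ∀ t ∈ Ioo ta tb, f t ∈ P.NVis W := by
    rintro t ⟨h1, h2⟩
    refine ⟨hfR t (hta0.trans h1.le) (h2.le.trans htb1), fun h => ?_⟩
    obtain ⟨u, hu, hut⟩ := mem_iUnion₂.1 h
    by_cases huw : u = w
    · subst huw
      exact h1.not_ge (htamax ⟨⟨hta0.trans h1.le, h2.le⟩, hut⟩)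
    · exact h2.not_ge (htbmin ⟨⟨hta0.trans h1.le, h2.le.trans htb1⟩,
        mem_biUnion (x := u) ⟨hu, huw⟩ hut⟩)
  have hfs : ∀ t : ℝ, f tb + t • (w' - z) = f (tb - t) := fun t => by simp only [f]; module
  let O : Set Plane := (⋃ u ∈ W \ {v}, P.Vis u)ᶜ
  have hO : IsOpen O := (hfin.sdiff.isClosed_biUnion fun u _ => isClosed_Vis u).isOpen_compl
  have hVO : P.Vis v ⊆ O := by
    intro x hx h
    obtain ⟨u, ⟨hu, huv⟩, hxu⟩ := mem_iUnion₂.1 h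
    have : x ∈ P.Vis u ∩ P.Vis v := ⟨hxu, hx⟩
    rw [hdisj u hu v hvW huv] at this
    exact this
  have hNV : O ∩ (P.region \ P.Vis v) ⊆ P.NVis W := by
    rintro x ⟨hxO, hxR, hxv⟩
    refine ⟨hxR, fun h => ?_⟩
    obtain ⟨u, hu, hxu⟩ := mem_iUnion₂.1 h
    by_cases huv : u = v
    · exact hxv (huv ▸ hxu)
    · exact hxO (mem_biUnion (x := u) ⟨hu, huv⟩ hxu)
  obtain ⟨e, t₀, he, hye, ht0, ht1, -, hecl⟩ := exists_window (s := w' - z) (t₁ := tb - ta)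
    (hreg v hvW) hyv (sub_pos.2 hlt) (fun t h0 h1 => by
      rw [hfs]
      have := hnv (tb - t) ⟨by linarith, by linarith⟩
      exact ⟨this.1, fun h => this.2 (mem_biUnion (x := v) hvW h)⟩) hO hVO
  rw [hfs] at hecl
  have hm : tb - t₀ ∈ Ioo ta tb := ⟨by linarith, by linarith⟩
  have hsub : f '' Ioo ta tb ⊆ connectedComponentIn (P.NVis W) (f (tb - t₀)) :=
    (isPreconnected_Ioo.image f hf.continuousOn).subset_connectedComponentIn ⟨_, hm, rfl⟩
      (image_subset_iff.2 hnv)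
  have hends : f '' Icc ta tb ⊆ closure (connectedComponentIn (P.NVis W) (f (tb - t₀))) := by
    rw [← closure_Ioo hlt.ne]
    exact (image_closure_subset_closure_image hf).trans (closure_mono hsub)
  have hadj : P.GConAdj W w v := by
    refine ⟨hw, hvW, hvw.symm, ?_⟩
    have h1 : JoinedIn (P.Vis w ∪ P.NVis W ∪ P.Vis v) w (f ta) := JoinedIn.of_segment_subset
      ((segment_subset_Vis htaw).trans (subset_union_left.trans subset_union_left))
    have h3 : JoinedIn (P.Vis w ∪ P.NVis W ∪ P.Vis v) (f tb) v := by
      refine JoinedIn.of_segment_subset ?_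
      rw [segment_symm]
      exact (segment_subset_Vis hyv).trans subset_union_right
    have h2 : JoinedIn (P.Vis w ∪ P.NVis W ∪ P.Vis v) (f ta) (f tb) := by
      refine ((((convex_Icc ta tb).isPathConnected ⟨ta, left_mem_Icc.2 hlt.le⟩).image hf).joinedIn
        _ ⟨ta, left_mem_Icc.2 hlt.le, rfl⟩ _ ⟨tb, right_mem_Icc.2 hlt.le, rfl⟩).mono ?_
      rintro _ ⟨t, ht, rfl⟩
      rcases ht.1.eq_or_lt with rfl | h1
      · exact Or.inl (Or.inl htaw)
      rcases ht.2.eq_or_lt with rfl | h2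
      · exact Or.inr hyv
      · exact Or.inl (Or.inr (hnv t ⟨h1, h2⟩))
    obtain ⟨γ, hγ⟩ := (h1.trans h2).trans h3
    exact ⟨range γ, γ, rfl, range_subset_iff.2 hγ⟩
  refine hcond v hadj _ ⟨_, hnv _ hm, rfl⟩
    ⟨_, hends ⟨ta, left_mem_Icc.2 hlt.le, rfl⟩, htaw⟩
    ⟨_, hends ⟨tb, right_mem_Icc.2 hlt.le, rfl⟩, hyv⟩ e he
    (hecl.trans (closure_mono (connectedComponentIn_mono _ hNV))) _ hye ?_
  have hvis : f tb ∈ P.Vis w' := segment_subset_Vis hzw (by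
    rw [segment_eq_image']
    exact ⟨tb, ⟨htb0, htb1⟩, rfl⟩)
  exact ⟨hvis.1, hw'.1, mem_Vis_iff.1 (mem_Vis_comm.1 hvis)⟩

end SimplePolygon

/-- A witness `w` can be replaced by any point `w' ∈ Vis w` that is not
visible from any attachment window of a neighbor. -/
theorem witness_replace_of_invisible_windows (P : SimplePolygon) (W : Set Plane)
    (hW : P.IsWitnessSet W) (hreg : ∀ u ∈ W, P.VisRegular u)
    (w : Plane) (hw : w ∈ W) (w' : Plane) (hw' : w' ∈ P.Vis w)
    (hcond : ∀ v : Plane, P.GConAdj W w v →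
      ∀ NV : Set Plane, IsCompOf NV (P.NVis W) →
        P.Attached NV w → P.Attached NV v →
          ∀ e : Set Plane, P.IsWindow v e → e ⊆ closure NV →
            ∀ x ∈ e, ¬ P.Visible x w') :
    P.IsWitnessSet ((W \ {w}) ∪ {w'}) ∧ ((W \ {w}) ∪ {w'}).ncard = W.ncard := by
  obtain ⟨hfin, hsub, hdisj⟩ := id hW
  have key : ∀ v ∈ W \ {w}, P.Vis w' ∩ P.Vis v = ∅ := fun v hv =>
    SimplePolygon.disjoint_Vis_of_invisible_windows hW hreg hw hw' hcond hv.1 hv.2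
  have hnot : w' ∉ W \ {w} := by
    intro h
    have h1 : w' ∈ P.Vis w' ∩ P.Vis w' :=
      ⟨SimplePolygon.self_mem_Vis hw'.1, SimplePolygon.self_mem_Vis hw'.1⟩
    rw [key w' h] at h1
    exact h1
  refine ⟨⟨hfin.sdiff.union (finite_singleton w'),
    union_subset (sdiff_subset.trans hsub) (singleton_subset_iff.2 hw'.1), ?_⟩, ?_⟩
  · rintro x (hx | rfl) y (hy | rfl) hxy
    · exact hdisj x hx.1 y hy.1 hxy
    · rw [inter_comm]
      exact key x hx
    · exact key y hy
    · exact absurd rfl hxy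
  · rw [union_singleton, ncard_insert_of_notMem hnot hfin.sdiff,
      ncard_sdiff_singleton_add_one hw hfin]
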